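/- arXiv:1001.1474 — 8 statements merged into one kernel-verified Lean document; each statement's English description precedes it below -/
import Mathlib

section
/- Let d ≥ 1 be an integer and ε > 0. Let (α,β) ∈ ℝ² be admissible and set μ̄ := max(2α+dβ, 2α+(d−2)β), μ̲ := min(2α+dβ, 2α+(d−2)β). Let f : ℝ → ℝ be twice differentiable satisfying the convexity conditions with parameter ε. Then for all u ∈ ℝ: α²·(u²·f″(u) + u·f′(u)) + α·(2dβ − μ̄ − μ̲)·u·f′(u) + (dβ − μ̄)·(dβ − μ̲)·f(u) ≥ (2αε/(d+1))·(α·u·f′(u) + dβ·f(u)) ≥ (2αεμ̄/(d+1))·f(u) ≥ 0. -/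
theorem stmt1 (d : ℕ) (hd : 1 ≤ d) (ε : ℝ) (hε : 0 < ε) (α β : ℝ)
    (hα : 0 ≤ α) (h1 : 0 ≤ 2*α + (d:ℝ)*β) (h2 : 0 ≤ 2*α + ((d:ℝ)-2)*β)
    (hne : (α, β) ≠ (0, 0))
    (f : ℝ → ℝ) (hf1 : Differentiable ℝ f) (hf2 : Differentiable ℝ (deriv f))
    (hpos : ∀ u : ℝ, 0 ≤ f u)
    (hconv1 : ∀ u : ℝ, (2 + 4/(d:ℝ) + ε) * f u ≤ u * deriv f u)
    (hconv2 : ∀ u : ℝ, 0 ≤ u^2 * deriv (deriv f) u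
        - (1 + (2 + 4/(d:ℝ) + ε)) * (u * deriv f u) + 2 * (2 + 4/(d:ℝ) + ε) * f u) :
    ∀ u : ℝ,
      ((2*α*ε/((d:ℝ)+1)) * (α * u * deriv f u + (d:ℝ)*β * f u)
          ≤ α^2 * (u^2 * deriv (deriv f) u + u * deriv f u)
            + α * (2*(d:ℝ)*β - max (2*α + (d:ℝ)*β) (2*α + ((d:ℝ)-2)*β)
                - min (2*α + (d:ℝ)*β) (2*α + ((d:ℝ)-2)*β)) * (u * deriv f u)
            + ((d:ℝ)*β - max (2*α + (d:ℝ)*β) (2*α + ((d:ℝ)-2)*β))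
              * ((d:ℝ)*β - min (2*α + (d:ℝ)*β) (2*α + ((d:ℝ)-2)*β)) * f u)
      ∧ ((2*α*ε*(max (2*α + (d:ℝ)*β) (2*α + ((d:ℝ)-2)*β))/((d:ℝ)+1)) * f u
          ≤ (2*α*ε/((d:ℝ)+1)) * (α * u * deriv f u + (d:ℝ)*β * f u))
      ∧ 0 ≤ (2*α*ε*(max (2*α + (d:ℝ)*β) (2*α + ((d:ℝ)-2)*β))/((d:ℝ)+1)) * f u := by
  intro u
  have hF := hpos u
  have hG := hconv1 u
  have hH := hconv2 u
  generalize f u = F at *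
  generalize deriv (deriv f) u = E at *
  generalize deriv f u = E' at *
  rw [mul_assoc α u E']
  generalize u * E' = G at *
  generalize u ^ 2 * E = H at *
  have hd1 : (1 : ℝ) ≤ d := by exact_mod_cast hd
  generalize (d : ℝ) = D at *
  have hD : 0 < D := by linarith
  have hαε : 0 ≤ α * ε := by positivity
  have hfac : 0 ≤ 2 * α * ε / (D + 1) := by positivity
  have hX : (4 / D + ε) * F ≤ G - 2 * F := by linarith
  have hX0 : 0 ≤ G - 2 * F := le_trans (by positivity) hX
  have hmax : 0 ≤ max (2*α + D*β) (2*α + (D-2)*β) := le_max_of_le_left h1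
  refine ⟨?_, ?_, ?_⟩
  · have hsum := max_add_min (2*α + D*β) (2*α + (D-2)*β)
    have hprod := max_mul_min (2*α + D*β) (2*α + (D-2)*β)
    generalize max (2*α + D*β) (2*α + (D-2)*β) = M at *
    generalize min (2*α + D*β) (2*α + (D-2)*β) = m at *
    have hlhs : α^2 * (H + G) + α * (2*D*β - M - m) * G + (D*β - M) * (D*β - m) * F
        = α * (α * H + (2*β - 3*α) * G + 4 * (α - β) * F) := by
      linear_combination (-α * G - D * β * F) * hsum + F * hprod
    have hbracket : α * ε * (G - 2*F) + 2 / D * (2*α + D*β) * (G - 2*F)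
        ≤ α * H + (2*β - 3*α) * G + 4 * (α - β) * F := by
      have hmul := mul_nonneg hα hH
      have hsplit : 2 / D * (2*α + D*β) = 4 / D * α + 2 * β := by
        field_simp
        ring
      rw [hsplit]
      linarith
    have hc : 2 / (D + 1) ≤ 1 := by
      rw [div_le_one (by linarith)]
      linarith
    have hcD : 2 / (D + 1) ≤ 2 / D := by gcongr; linarith
    have hεF : ε * F ≤ G - 2 * F :=
      le_trans (mul_le_mul_of_nonneg_right (le_add_of_nonneg_left (by positivity)) hF) hX
    have hfirst : 2 / (D + 1) * (α * ε * (G - 2*F)) ≤ α * ε * (G - 2*F) :=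
      mul_le_of_le_one_left (by positivity) hc
    have hsecond : 2 / (D + 1) * (2*α + D*β) * (ε * F)
        ≤ 2 / D * (2*α + D*β) * (G - 2*F) := by gcongr
    rw [hlhs]
    calc 2*α*ε/(D+1) * (α * G + D*β * F)
        = α * (2 / (D + 1) * (α * ε * (G - 2*F))
            + 2 / (D + 1) * (2*α + D*β) * (ε * F)) := by ring
      _ ≤ _ := mul_le_mul_of_nonneg_left (by linarith) hα
  · rw [mul_div_right_comm, mul_assoc]
    refine mul_le_mul_of_nonneg_left ?_ hfac
    have hαX := mul_nonneg hα hX0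
    have hβF : -(2 * β) * F ≤ α * (G - 2 * F) := by
      have hβ : -(2 * β) ≤ α * (4 / D) := by
        rw [mul_div_assoc', le_div_iff₀ hD]
        linarith
      calc -(2 * β) * F ≤ α * (4 / D) * F := by gcongr
        _ ≤ α * (4 / D + ε) * F := by gcongr; linarith
        _ ≤ α * (G - 2 * F) := by
          rw [mul_assoc]
          gcongr
    rcases max_choice (2*α + D*β) (2*α + (D-2)*β) with h | h <;> rw [h] <;> linarith
  · exact mul_nonneg (div_nonneg (by positivity) (by linarith)) hF
end

section
/- Let p > 4, κ₀ ≥ 0 and γ ∈ ℝ, and suppose that 8κ₀u² + 3γu + 2(p−4) > 0 for all u ≥ 0. Define f(u) := u^p·e^{κ₀u² + γu} for u ≥ 0. Then for all u > 0: u·f′(u) ≥ 4·f(u) and u²·f″(u) − 5·u·f′(u) + 8·f(u) ≥ 0. -/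
theorem hasDerivAt_rpow_mul_exp_quadratic (p κ γ : ℝ) {u : ℝ} (hu : 0 < u) :
    HasDerivAt (fun x : ℝ => x ^ p * Real.exp (κ * x ^ 2 + γ * x))
      (u ^ p * Real.exp (κ * u ^ 2 + γ * u) * (2 * κ * u + γ + p / u)) u := by
  have hpow : HasDerivAt (fun x : ℝ => x ^ p) (p * u ^ (p - 1)) u :=
    Real.hasDerivAt_rpow_const (Or.inl hu.ne')
  have hquad : HasDerivAt (fun x : ℝ => κ * x ^ 2 + γ * x) (2 * κ * u + γ) u := by
    refine (((hasDerivAt_pow 2 u).const_mul κ).add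
      ((hasDerivAt_id u).const_mul γ)).congr_deriv ?_
    norm_num
    ring
  refine (hpow.mul hquad.exp).congr_deriv ?_
  rw [Real.rpow_sub_one hu.ne']
  ring

theorem stmt4 (p κ₀ γ : ℝ) (hp : 4 < p) (hκ : 0 ≤ κ₀)
    (hcond : ∀ u : ℝ, 0 ≤ u → 0 < 8*κ₀*u^2 + 3*γ*u + 2*(p-4))
    (f : ℝ → ℝ) (hf : ∀ u : ℝ, 0 ≤ u → f u = u ^ p * Real.exp (κ₀*u^2 + γ*u)) :
    ∀ u : ℝ, 0 < u →
      4 * f u ≤ u * deriv f u ∧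
      0 ≤ u^2 * deriv (deriv f) u - 5 * (u * deriv f u) + 8 * f u := by
  have hderiv : ∀ u : ℝ, 0 < u → HasDerivAt f (f u * (2 * κ₀ * u + γ + p / u)) u := by
    intro u hu
    rw [hf u hu.le]
    refine (hasDerivAt_rpow_mul_exp_quadratic p κ₀ γ hu).congr_of_eventuallyEq ?_
    filter_upwards [Ioi_mem_nhds hu] with x hx using hf x (le_of_lt hx)
  intro u hu
  have hfpos : 0 < f u := by
    rw [hf u hu.le]
    positivity
  have hlog : HasDerivAt (fun x : ℝ => 2 * κ₀ * x + γ + p / x) (2 * κ₀ - p / u ^ 2) u := by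
    refine ((((hasDerivAt_id u).const_mul (2 * κ₀)).add_const γ).add
      ((hasDerivAt_inv hu.ne').const_mul p)).congr_deriv ?_
    ring
  have hderiv2 : deriv (deriv f) u =
      f u * ((2 * κ₀ * u + γ + p / u) ^ 2 + (2 * κ₀ - p / u ^ 2)) := by
    have heq : deriv f =ᶠ[nhds u] fun x => f x * (2 * κ₀ * x + γ + p / x) := by
      filter_upwards [Ioi_mem_nhds hu] with x hx using (hderiv x hx).deriv
    rw [heq.deriv_eq, ((hderiv u hu).fun_mul hlog).deriv]
    ring
  have hfirst : u * deriv f u = (2 * κ₀ * u ^ 2 + γ * u + p) * f u := by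
    rw [(hderiv u hu).deriv]
    field_simp
  constructor
  · rw [hfirst]
    have hgrowth : 4 ≤ 2 * κ₀ * u ^ 2 + γ * u + p := by
      have := hcond (2 / 3 * u) (by positivity)
      have : 0 ≤ κ₀ * u ^ 2 := by positivity
      linarith
    gcongr
  · have hfactor : u ^ 2 * deriv (deriv f) u - 5 * (u * deriv f u) + 8 * f u =
        ((2 * κ₀ * u ^ 2 + γ * u + p - 4) ^ 2 +
          (8 * κ₀ * u ^ 2 + 3 * γ * u + 2 * (p - 4))) * f u := by
      rw [hfirst, hderiv2]
      field_simp
      ring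
    rw [hfactor]
    have := hcond u hu.le
    positivity
end

section
/- Let p > 2, κ > 0 and q > 1 with (4−p)·q < 2, and set q′ := q/(q−1). Then there is a constant C > 0, depending only on p, κ, q, such that for every real-valued Schwartz function φ on ℝ² with q·κ·∫_{ℝ²}|∇φ|² dx ≤ 2π, one has ∫_{ℝ²} |φ(x)|^p·(e^{κ·φ(x)²} − 1) dx ≤ C·(∫_{ℝ²} φ² dx)·(∫_{ℝ²}|∇φ|² dx)^{(p − 2/q′)/2}. -/
open MeasureTheory Filter Topology

theorem two_mul_enorm_le_lintegral_enorm_deriv {f f' : ℝ → ℝ}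
    (hf : ∀ x, HasDerivAt f (f' x) x) (hf' : Continuous f')
    (hbot : Tendsto f atBot (𝓝 0)) (htop : Tendsto f atTop (𝓝 0)) (x : ℝ) :
    2 * ‖f x‖ₑ ≤ ∫⁻ t, ‖f' t‖ₑ := by
  rcases eq_or_ne (∫⁻ t, ‖f' t‖ₑ) ⊤ with h | h
  · simp [h]
  have hint : Integrable f' := ⟨hf'.aestronglyMeasurable, lt_top_iff_ne_top.2 h⟩
  have h1 := integral_Iic_of_hasDerivAt_of_tendsto (a := x)
    (hf x).continuousAt.continuousWithinAt (fun t _ => hf t) hint.integrableOn hbot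
  have h2 := integral_Ioi_of_hasDerivAt_of_tendsto (a := x)
    (hf x).continuousAt.continuousWithinAt (fun t _ => hf t) hint.integrableOn htop
  have h3 : ‖f x‖ₑ ≤ ∫⁻ t in Set.Iic x, ‖f' t‖ₑ := by
    have := enorm_integral_le_lintegral_enorm (μ := volume.restrict (Set.Iic x)) f'
    rwa [h1, sub_zero] at this
  have h4 : ‖f x‖ₑ ≤ ∫⁻ t in Set.Ioi x, ‖f' t‖ₑ := by
    have := enorm_integral_le_lintegral_enorm (μ := volume.restrict (Set.Ioi x)) f'
    rwa [h2, zero_sub, enorm_neg] at this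
  rw [two_mul, ← setLIntegral_univ, ← Set.Iic_union_Ioi (a := x),
    lintegral_union measurableSet_Ioi (by simp [Set.disjoint_left])]
  exact add_le_add h3 h4

theorem ENNReal.four_mul_mul_le_add_sq (a b : ENNReal) : 4 * (a * b) ≤ (a + b) ^ 2 := by
  induction a with
  | top => simp
  | coe a =>
    induction b with
    | top => simp
    | coe b =>
      norm_cast
      rw [← NNReal.coe_le_coe]
      push_cast
      nlinarith [sq_nonneg ((a : ℝ) - b)]

theorem measurePreserving_pair_euclideanSpace :
    MeasurePreserving (fun z : ℝ × ℝ => (!₂[z.1, z.2] : EuclideanSpace ℝ (Fin 2))) := by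
  have := (PiLp.volume_preserving_toLp (Fin 2)).comp (volume_preserving_finTwoArrow ℝ).symm
  exact this

theorem abs_apply_add_abs_apply_le (l : EuclideanSpace ℝ (Fin 2) →L[ℝ] ℝ) :
    |l !₂[1, 0]| + |l !₂[0, 1]| ≤ √2 * ‖l‖ := by
  have key : ∀ s t : ℝ, s ^ 2 = 1 → t ^ 2 = 1 → s * l !₂[1, 0] + t * l !₂[0, 1] ≤ √2 * ‖l‖ := by
    intro s t hs ht
    have h1 : s * l !₂[1, 0] + t * l !₂[0, 1] = l !₂[s, t] := by
      rw [← smul_eq_mul, ← smul_eq_mul, ← map_smul, ← map_smul, ← map_add]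
      congr 1
      ext i
      fin_cases i <;> simp
    rw [h1, mul_comm]
    refine (le_abs_self _).trans ((l.le_opNorm _).trans_eq ?_)
    rw [EuclideanSpace.norm_eq]
    simp [Fin.sum_univ_two, hs, ht]
    norm_num
  rcases abs_cases (l !₂[1, 0]) with h1 | h1 <;> rcases abs_cases (l !₂[0, 1]) with h2 | h2
  · linarith [key 1 1 (by norm_num) (by norm_num)]
  · linarith [key 1 (-1) (by norm_num) (by norm_num)]
  · linarith [key (-1) 1 (by norm_num) (by norm_num)]
  · linarith [key (-1) (-1) (by norm_num) (by norm_num)]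

theorem eight_mul_lintegral_enorm_sq_le {f : EuclideanSpace ℝ (Fin 2) → ℝ}
    (hf : ContDiff ℝ 1 f) (hlim : Tendsto f (cocompact _) (𝓝 0)) :
    8 * ∫⁻ x, ‖f x‖ₑ ^ 2 ≤ (∫⁻ x, ‖fderiv ℝ f x‖ₑ) ^ 2 := by
  set L : ℝ × ℝ → EuclideanSpace ℝ (Fin 2) := fun z => !₂[z.1, z.2] with hL
  have hLm : MeasurePreserving L := measurePreserving_pair_euclideanSpace
  have hLc : Continuous L := by
    rw [hL]; fun_prop
  have hdf : Continuous (fderiv ℝ f) := hf.continuous_fderiv one_ne_zero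
  have hdiff : Differentiable ℝ f := hf.differentiable one_ne_zero
  have hfc : Continuous f := hf.continuous
  set e₀ : EuclideanSpace ℝ (Fin 2) := !₂[1, 0]
  set e₁ : EuclideanSpace ℝ (Fin 2) := !₂[0, 1]
  have hLe : ∀ x y, L (x, y) = x • e₀ + y • e₁ := by
    intro x y
    ext i
    fin_cases i <;> simp [hL, e₀, e₁]
  have hcobdd : ∀ {F : Filter ℝ} {c : ℝ → EuclideanSpace ℝ (Fin 2)} (i : Fin 2),
      Tendsto (fun t => |c t i|) F atTop → Tendsto (fun t => f (c t)) F (𝓝 0) := by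
    intro F c i h
    refine hlim.comp ?_
    rw [← Metric.cobounded_eq_cocompact, ← tendsto_norm_atTop_iff_cobounded]
    exact tendsto_atTop_mono (fun t => PiLp.norm_apply_le (c t) i) h
  set A : ℝ × ℝ → ENNReal := fun z => ‖fderiv ℝ f (L z) e₀‖ₑ with hA
  set B : ℝ × ℝ → ENNReal := fun z => ‖fderiv ℝ f (L z) e₁‖ₑ with hB
  have hAc : Continuous A := by rw [hA]; fun_prop
  have hBc : Continuous B := by rw [hB]; fun_prop
  have h1 : ∀ x y, 2 * ‖f (L (x, y))‖ₑ ≤ ∫⁻ t, A (t, y) := by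
    intro x y
    refine two_mul_enorm_le_lintegral_enorm_deriv (f := fun t => f (L (t, y)))
      (f' := fun t => fderiv ℝ f (L (t, y)) e₀) (fun t => ?_) (by fun_prop)
      (hcobdd 0 (by simpa [hL] using tendsto_abs_atBot_atTop))
      (hcobdd 0 (by simpa [hL] using tendsto_abs_atTop_atTop)) x
    refine (hdiff (L (t, y))).hasFDerivAt.comp_hasDerivAt t (f := fun t => L (t, y)) ?_
    have := ((hasDerivAt_id t).smul_const e₀).add_const (y • e₁)
    rw [one_smul] at this
    simpa only [hLe, id] using this
  have h2 : ∀ x y, 2 * ‖f (L (x, y))‖ₑ ≤ ∫⁻ t, B (x, t) := by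
    intro x y
    refine two_mul_enorm_le_lintegral_enorm_deriv (f := fun t => f (L (x, t)))
      (f' := fun t => fderiv ℝ f (L (x, t)) e₁) (fun t => ?_) (by fun_prop)
      (hcobdd 1 (by simpa [hL] using tendsto_abs_atBot_atTop))
      (hcobdd 1 (by simpa [hL] using tendsto_abs_atTop_atTop)) y
    refine (hdiff (L (x, t))).hasFDerivAt.comp_hasDerivAt t (f := fun t => L (x, t)) ?_
    have := ((hasDerivAt_id t).smul_const e₁).const_add (x • e₀)
    rw [one_smul] at this
    simpa only [hLe, id] using this
  have hprod : 4 * ∫⁻ x, ‖f x‖ₑ ^ 2 ≤ (∫⁻ z, B z) * ∫⁻ z, A z := by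
    have hBi : ∫⁻ z, B z = ∫⁻ x, ∫⁻ t, B (x, t) :=
      lintegral_prod _ hBc.measurable.aemeasurable
    have hAi : ∫⁻ z, A z = ∫⁻ y, ∫⁻ t, A (t, y) :=
      lintegral_prod_symm _ hAc.measurable.aemeasurable
    have hm := lintegral_prod_mul (μ := (volume : Measure ℝ)) (ν := (volume : Measure ℝ))
      (f := fun x => ∫⁻ t, B (x, t)) (g := fun y => ∫⁻ t, A (t, y))
      hBc.measurable.lintegral_prod_right'.aemeasurable
      hAc.measurable.lintegral_prod_left'.aemeasurable
    rw [hBi, hAi, ← hm, ← hLm.lintegral_comp (by fun_prop),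
      ← lintegral_const_mul _
        ((show Continuous fun z => f (L z) from hfc.comp hLc).enorm.measurable.pow_const 2)]
    refine lintegral_mono fun z => ?_
    calc 4 * ‖f (L z)‖ₑ ^ 2 = (2 * ‖f (L z)‖ₑ) * (2 * ‖f (L z)‖ₑ) := by ring
      _ ≤ _ := mul_le_mul' (h2 z.1 z.2) (h1 z.1 z.2)
  have hsum : (∫⁻ z, B z) + ∫⁻ z, A z ≤ ENNReal.ofReal √2 * ∫⁻ x, ‖fderiv ℝ f x‖ₑ := by
    rw [← lintegral_add_left hBc.measurable, ← hLm.lintegral_comp (by fun_prop),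
      ← lintegral_const_mul _ (by fun_prop)]
    refine lintegral_mono fun z => ?_
    simp only [hA, hB, ← ofReal_norm, Real.norm_eq_abs]
    rw [← ENNReal.ofReal_mul (by positivity), ← ENNReal.ofReal_add (by positivity) (by positivity)]
    refine ENNReal.ofReal_le_ofReal ?_
    rw [add_comm]
    exact abs_apply_add_abs_apply_le _
  have hfin : 2 * (8 * ∫⁻ x, ‖f x‖ₑ ^ 2) ≤ 2 * (∫⁻ x, ‖fderiv ℝ f x‖ₑ) ^ 2 := by
    calc 2 * (8 * ∫⁻ x, ‖f x‖ₑ ^ 2) = 4 * (4 * ∫⁻ x, ‖f x‖ₑ ^ 2) := by ring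
      _ ≤ 4 * ((∫⁻ z, B z) * ∫⁻ z, A z) := by gcongr
      _ ≤ _ := ENNReal.four_mul_mul_le_add_sq _ _
      _ ≤ _ := pow_le_pow_left' hsum 2
      _ = _ := by
        rw [mul_pow, ← ENNReal.ofReal_pow (by positivity), Real.sq_sqrt (by norm_num)]
        simp
  rwa [ENNReal.mul_le_mul_iff_right (by norm_num) (by norm_num)] at hfin

theorem exists_contDiff_truncation {a b : ℝ} (ha : 0 < a) (hab : a < b) :
    ∃ F : ℝ → ℝ, ContDiff ℝ 1 F ∧ F 0 = 0 ∧ (∀ s, |deriv F s| ≤ 1) ∧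
      (∀ s, ¬ (a ≤ |s| ∧ |s| < b) → deriv F s = 0) ∧
      ∀ s, b ≤ |s| → 20 / 21 * (b - a) ≤ |F s| := by
  have hba : 0 < b - a := sub_pos.2 hab
  set z : ℝ → ℝ := fun s => (2 * |s| - a - b) / (b - a) with hz
  set η : ℝ → ℝ := fun s => max 0 (1 - z s ^ 20) with hη
  have hηc : Continuous η := by rw [hη, hz]; fun_prop
  have hη0 : ∀ s, 0 ≤ η s := fun s => le_max_left _ _
  have hη1 : ∀ s, η s ≤ 1 := fun s =>
    max_le zero_le_one (sub_le_self _ (by rw [show 20 = 2 * 10 by rfl, pow_mul]; positivity))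
  have hηneg : ∀ s, η (-s) = η s := fun s => by simp [hη, hz]
  set F : ℝ → ℝ := fun s => ∫ t in (0 : ℝ)..s, η t with hF
  have hderiv : ∀ s, HasDerivAt F (η s) s := fun s =>
    intervalIntegral.integral_hasDerivAt_right (hηc.intervalIntegrable _ _)
      (hηc.stronglyMeasurableAtFilter _ _) hηc.continuousAt
  have hderiv' : deriv F = η := funext fun s => (hderiv s).deriv
  have hlow : 20 / 21 * (b - a) ≤ ∫ t in a..b, η t := by
    have h1 : ∫ t in a..b, (1 - ((2 * t - a - b) / (b - a)) ^ 20) = 20 / 21 * (b - a) := by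
      have hd : ∀ t ∈ Set.uIcc a b,
          HasDerivAt (fun t => t - (b - a) / 42 * ((2 * t - a - b) / (b - a)) ^ 21)
            (1 - ((2 * t - a - b) / (b - a)) ^ 20) t := by
        intro t _
        have h2 : HasDerivAt (fun t => (2 * t - a - b) / (b - a)) (2 / (b - a)) t := by
          have := ((((hasDerivAt_id t).const_mul 2).sub_const a).sub_const b).div_const (b - a)
          simpa using this
        convert! (hasDerivAt_id t).sub ((h2.pow 21).const_mul ((b - a) / 42)) using 1
        push_cast
        have := hba.ne'
        field_simp
        ring
      rw [intervalIntegral.integral_eq_sub_of_hasDerivAt hd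
        (Continuous.intervalIntegrable (by fun_prop) _ _)]
      have e1 : (2 * b - a - b) / (b - a) = 1 := by
        rw [div_eq_one_iff_eq hba.ne']; ring
      have e2 : (2 * a - a - b) / (b - a) = -1 := by
        rw [div_eq_iff hba.ne']; ring
      rw [e1, e2]
      ring
    rw [← h1]
    refine intervalIntegral.integral_mono_on hab.le
      (Continuous.intervalIntegrable (by fun_prop) _ _) (hηc.intervalIntegrable _ _) ?_
    intro t ht
    simp only [hη, hz, abs_of_nonneg (ha.le.trans ht.1)]
    exact le_max_right _ _
  have hpos : ∀ s, b ≤ s → 20 / 21 * (b - a) ≤ F s := by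
    intro s hs
    refine hlow.trans (intervalIntegral.integral_mono_interval ha.le hab.le hs
      (Eventually.of_forall hη0) (hηc.intervalIntegrable _ _))
  have hodd : ∀ s, F (-s) = -F s := by
    intro s
    have := intervalIntegral.integral_comp_neg (a := 0) (b := s) η
    simp only [hηneg, neg_zero] at this
    simp only [hF]
    rw [this, intervalIntegral.integral_symm]
  refine ⟨F, ?_, by simp [hF], ?_, ?_, ?_⟩
  · rw [contDiff_one_iff_deriv]
    exact ⟨fun s => (hderiv s).differentiableAt, hderiv' ▸ hηc⟩
  · intro s
    rw [hderiv', abs_of_nonneg (hη0 s)]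
    exact hη1 s
  · intro s hs
    rw [hderiv']
    refine max_eq_left (sub_nonpos.2 ?_)
    have : 1 ≤ |z s| := by
      simp only [hz, abs_div, abs_of_pos hba]
      rw [one_le_div hba]
      by_cases h : a ≤ |s|
      · have : b ≤ |s| := not_lt.1 fun h' => hs ⟨h, h'⟩
        exact le_trans (by linarith) (le_abs_self _)
      · exact le_trans (by linarith) (neg_le_abs _)
    calc 1 ≤ |z s| ^ 20 := one_le_pow₀ this
      _ = z s ^ 20 := Even.pow_abs (by decide) _
  · intro s hs
    rcases abs_cases s with h | h
    · exact (hpos s (h.1 ▸ hs)).trans (le_abs_self _)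
    · have := hpos (-s) (h.1 ▸ hs)
      rw [hodd] at this
      exact this.trans (neg_le_abs _)

theorem sq_lintegral_le_measure_mul_lintegral_sq {α : Type*} [MeasurableSpace α] {μ : Measure α}
    {g : α → ENNReal} (hg : AEMeasurable g μ) :
    (∫⁻ x, g x ∂μ) ^ 2 ≤ μ Set.univ * ∫⁻ x, g x ^ 2 ∂μ := by
  have h := ENNReal.lintegral_mul_le_Lp_mul_Lq μ Real.HolderConjugate.two_two hg
    (aemeasurable_const (b := (1 : ENNReal)))
  simp only [Pi.mul_apply, mul_one, lintegral_const,
    ENNReal.rpow_two] at h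
  refine (pow_le_pow_left' h 2).trans_eq ?_
  rw [mul_pow, ← ENNReal.rpow_natCast, ← ENNReal.rpow_natCast, ← ENNReal.rpow_mul,
    ← ENNReal.rpow_mul, mul_comm]
  norm_num

theorem measureReal_superlevel_step {u : EuclideanSpace ℝ (Fin 2) → ℝ} (hu : ContDiff ℝ 1 u)
    (hlim : Tendsto u (cocompact _) (𝓝 0)) (hu2 : Integrable fun x => u x ^ 2)
    (hdu : Integrable fun x => ‖fderiv ℝ u x‖ ^ 2) {a b : ℝ} (ha : 0 < a) (hab : a < b) :
    3200 / 441 * (b - a) ^ 2 * volume.real {x | b ≤ |u x|} ≤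
      (volume.real {x | a ≤ |u x|} - volume.real {x | b ≤ |u x|}) *
        ((∫ x in {x | a ≤ |u x|}, ‖fderiv ℝ u x‖ ^ 2) -
          ∫ x in {x | b ≤ |u x|}, ‖fderiv ℝ u x‖ ^ 2) := by
  obtain ⟨F, hF, hF0, hF1, hFsupp, hFlow⟩ := exists_contDiff_truncation ha hab
  have huc : Continuous u := hu.continuous
  have hduc : Continuous (fderiv ℝ u) := hu.continuous_fderiv one_ne_zero
  have hba : 0 < b - a := sub_pos.2 hab
  have hmeas : ∀ t, MeasurableSet {x | t ≤ |u x|} := fun t =>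
    measurableSet_le measurable_const huc.abs.measurable
  have hfin : ∀ t, 0 < t → volume {x | t ≤ |u x|} ≠ ⊤ := by
    intro t ht
    have := hu2.measure_ge_lt_top (pow_pos ht 2)
    refine ne_top_of_le_ne_top this.ne (measure_mono fun x hx => ?_)
    simp only [Set.mem_ofPred_eq] at hx ⊢
    rw [← sq_abs (u x)]
    gcongr
  set S : Set (EuclideanSpace ℝ (Fin 2)) := {x | a ≤ |u x|} \ {x | b ≤ |u x|} with hS
  have hsub : {x | b ≤ |u x|} ⊆ {x | a ≤ |u x|} := fun x hx => hab.le.trans hx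
  have hSm : MeasurableSet S := (hmeas a).diff (hmeas b)
  have hSvol : volume.real S = volume.real {x | a ≤ |u x|} - volume.real {x | b ≤ |u x|} :=
    measureReal_sdiff hsub (hmeas b) (hfin a ha)
  have hSint : ∫ x in S, ‖fderiv ℝ u x‖ ^ 2 = (∫ x in {x | a ≤ |u x|}, ‖fderiv ℝ u x‖ ^ 2) -
          ∫ x in {x | b ≤ |u x|}, ‖fderiv ℝ u x‖ ^ 2 :=
    setIntegral_sdiff (hmeas b) hdu.integrableOn hsub
  have hfd : ∀ x, fderiv ℝ (F ∘ u) x = deriv F (u x) • fderiv ℝ u x := fun x =>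
    (((hF.differentiable one_ne_zero (u x)).hasDerivAt).comp_hasFDerivAt x
      (hu.differentiable one_ne_zero x).hasFDerivAt).fderiv
  have hS1 : ∫⁻ x, ‖fderiv ℝ (F ∘ u) x‖ₑ ≤ ∫⁻ x in S, ‖fderiv ℝ u x‖ₑ := by
    rw [← lintegral_indicator hSm]
    refine lintegral_mono fun x => ?_
    rw [hfd, enorm_smul]
    by_cases hx : x ∈ S
    · rw [Set.indicator_of_mem hx]
      refine mul_le_of_le_one_left' ?_
      rw [← ofReal_norm, Real.norm_eq_abs]
      exact ENNReal.ofReal_le_one.2 (hF1 _)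
    · rw [hFsupp (u x) (fun h => hx ⟨h.1, not_le.2 h.2⟩)]
      simp
  have hgag := eight_mul_lintegral_enorm_sq_le (hF.comp hu)
    ((hF.continuous.tendsto' 0 0 hF0).comp hlim)
  have hupper : (∫⁻ x in S, ‖fderiv ℝ u x‖ₑ) ^ 2 ≤
      ENNReal.ofReal (volume.real S * ∫ x in S, ‖fderiv ℝ u x‖ ^ 2) := by
    refine (sq_lintegral_le_measure_mul_lintegral_sq hduc.enorm.measurable.aemeasurable).trans_eq ?_
    rw [ENNReal.ofReal_mul measureReal_nonneg, ofReal_measureReal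
      (ne_top_of_le_ne_top (hfin a ha) (measure_mono Set.sdiff_subset)),
      ofReal_integral_eq_lintegral_ofReal hdu.integrableOn
        (Eventually.of_forall fun x => by positivity), Measure.restrict_apply_univ]
    simp only [ENNReal.ofReal_pow (norm_nonneg _), ofReal_norm]
    rfl
  have hlower : ENNReal.ofReal ((20 / 21 * (b - a)) ^ 2 * volume.real {x | b ≤ |u x|}) ≤
      ∫⁻ x, ‖(F ∘ u) x‖ₑ ^ 2 := by
    rw [ENNReal.ofReal_mul (by positivity), ofReal_measureReal (hfin b (ha.trans hab)),
      ← setLIntegral_const]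
    refine (setLIntegral_mono' (hmeas b) fun x hx => ?_).trans (setLIntegral_le_lintegral _ _)
    rw [← ofReal_norm, ← ENNReal.ofReal_pow (norm_nonneg _), Real.norm_eq_abs]
    refine ENNReal.ofReal_le_ofReal ?_
    have := hFlow (u x) hx
    gcongr
    exact this
  have hall := (mul_le_mul_right hlower 8).trans
    (hgag.trans ((pow_le_pow_left' hS1 2).trans hupper))
  rw [← ENNReal.ofReal_ofNat 8, ← ENNReal.ofReal_mul (by norm_num), ENNReal.ofReal_le_ofReal_iff
    (mul_nonneg measureReal_nonneg (by positivity)), hSvol, hSint] at hall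
  refine le_trans (le_of_eq ?_) hall
  ring

theorem div_add_le_mul_exp {d δ k : ℝ} (hd : 0 ≤ d) (hδ : 0 < δ) (hk : 0 < k) :
    d / (d + k) ≤ δ / (δ + k) * Real.exp (k / (δ * (δ + k)) * (d - δ)) := by
  have h1 : d / (d + k) ≤ δ / (δ + k) * (k / (δ * (δ + k)) * (d - δ) + 1) := by
    rw [div_le_iff₀ (by positivity), ← sub_nonneg]
    have : δ / (δ + k) * (k / (δ * (δ + k)) * (d - δ) + 1) * (d + k) - d =
        k * (d - δ) ^ 2 / (δ + k) ^ 2 := by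
      field_simp
      ring
    rw [this]
    positivity
  exact h1.trans (mul_le_mul_of_nonneg_left (Real.add_one_le_exp _) (by positivity))

theorem mul_exp_le_of_forall_step {m e : ℝ → ℝ} {K D : ℝ} (hK : 0 < K) (hD : 0 < D)
    (hm : ∀ t, 0 ≤ m t) (he : Antitone e) (he0 : ∀ t, 0 ≤ e t) (heD : ∀ t, e t ≤ D)
    (hstep : ∀ a b, 0 < a → a < b → K * (b - a) ^ 2 * m b ≤ (m a - m b) * (e a - e b))
    {a b : ℝ} (ha : 0 < a) (hab : a < b) :
    m b * Real.exp (K * (b - a) ^ 2 / D) ≤ m a := by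
  have hba : 0 < b - a := sub_pos.2 hab
  have hn : ∀ n : ℕ, 0 < n → m b * (1 + K * (b - a) ^ 2 / D / n) ^ n ≤ m a := by
    intro n hn
    have hn' : (0 : ℝ) < n := Nat.cast_pos.2 hn
    set h : ℝ := (b - a) / n with hh
    have hhpos : 0 < h := by positivity
    set δ : ℝ := D / n with hδ
    have hδpos : 0 < δ := by positivity
    set k : ℝ := K * h ^ 2 with hk
    have hkpos : 0 < k := by positivity
    set c : ℝ := k / (δ * (δ + k)) with hc
    have hcpos : 0 < c := by positivity
    have hind : ∀ j : ℕ, m (a + j * h) ≤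
        m a * (δ / (δ + k)) ^ j * Real.exp (c * (e a - e (a + j * h) - j * δ)) := by
      intro j
      induction j with
      | zero => simp
      | succ j ih =>
        set s : ℝ := a + j * h with hs
        have hs' : a + ((j + 1 : ℕ) : ℝ) * h = s + h := by rw [hs]; push_cast; ring
        rw [hs']
        have h1 := hstep s (s + h) (by positivity) (by linarith)
        rw [add_sub_cancel_left] at h1
        set d : ℝ := e s - e (s + h) with hd
        have hd0 : 0 ≤ d := sub_nonneg.2 (he (by linarith))
        have h2 : m (s + h) ≤ m s * (d / (d + k)) := by
          rw [← mul_div_assoc, le_div_iff₀ (by positivity)]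
          linarith
        calc m (s + h) ≤ m s * (d / (d + k)) := h2
          _ ≤ (m a * (δ / (δ + k)) ^ j * Real.exp (c * (e a - e s - j * δ))) *
              (δ / (δ + k) * Real.exp (c * (d - δ))) :=
            mul_le_mul ih (div_add_le_mul_exp hd0 hδpos hkpos) (by positivity)
              ((hm s).trans ih)
          _ = m a * (δ / (δ + k)) ^ (j + 1) *
              (Real.exp (c * (e a - e s - j * δ)) * Real.exp (c * (d - δ))) := by ring
          _ = _ := by
            rw [← Real.exp_add, hd]
            congr 2
            push_cast
            ring
    have hb : a + n * h = b := by rw [hh]; field_simp; ring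
    have h1 := hind n
    rw [hb] at h1
    have h2 : m b ≤ m a * (δ / (δ + k)) ^ n := by
      refine h1.trans (mul_le_of_le_one_right (mul_nonneg (hm a) (by positivity)) ?_)
      rw [Real.exp_le_one_iff]
      refine mul_nonpos_of_nonneg_of_nonpos hcpos.le ?_
      have : (n : ℝ) * δ = D := by rw [hδ]; field_simp
      linarith [he0 b, heD a]
    have h3 : 1 + K * (b - a) ^ 2 / D / n = (δ / (δ + k))⁻¹ := by
      rw [hδ, hk, hh]
      field_simp
    rw [h3, inv_pow, ← div_eq_mul_inv, div_le_iff₀ (by positivity)]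
    exact h2
  refine le_of_tendsto ((Real.tendsto_one_add_div_pow_exp _).const_mul (m b)) ?_
  filter_upwards [eventually_gt_atTop 0] with n h using hn n h

theorem measureReal_superlevel_le {u : EuclideanSpace ℝ (Fin 2) → ℝ} (hu : ContDiff ℝ 1 u)
    (hlim : Tendsto u (cocompact _) (𝓝 0)) (hu2 : Integrable fun x => u x ^ 2)
    (hdu : Integrable fun x => ‖fderiv ℝ u x‖ ^ 2)
    (hD : 0 < ∫ x, ‖fderiv ℝ u x‖ ^ 2) {t : ℝ} (ht : 0 < t) :
    volume.real {x | t ≤ |u x|} ≤ 400 * (∫ x, u x ^ 2) / t ^ 2 *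
      Real.exp (-(13 / 2 * t ^ 2 / ∫ x, ‖fderiv ℝ u x‖ ^ 2)) := by
  set D : ℝ := ∫ x, ‖fderiv ℝ u x‖ ^ 2 with hDdef
  have hnn : ∀ (μ : Measure (EuclideanSpace ℝ (Fin 2))), 0 ≤ᵐ[μ] fun x => ‖fderiv ℝ u x‖ ^ 2 :=
    fun μ => Eventually.of_forall fun x => by positivity
  have h1 := mul_exp_le_of_forall_step (m := fun t => volume.real {x | t ≤ |u x|})
    (e := fun t => ∫ x in {x | t ≤ |u x|}, ‖fderiv ℝ u x‖ ^ 2) (K := 3200 / 441) (by norm_num) hD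
    (fun t => measureReal_nonneg)
    (fun s t hst => setIntegral_mono_set hdu.integrableOn (hnn _)
      (Eventually.of_forall fun x hx => le_trans hst hx))
    (fun t => integral_nonneg fun x => by positivity)
    (fun t => setIntegral_le_integral hdu (hnn _))
    (fun a b ha hab => measureReal_superlevel_step hu hlim hu2 hdu ha hab)
    (a := t / 20) (b := t) (by positivity) (by linarith)
  have h2 : volume.real {x | t / 20 ≤ |u x|} ≤ 400 * (∫ x, u x ^ 2) / t ^ 2 := by
    have h := mul_meas_ge_le_integral_of_nonneg (Eventually.of_forall fun x => sq_nonneg (u x)) hu2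
      ((t / 20) ^ 2)
    have hset : {x | (t / 20) ^ 2 ≤ u x ^ 2} = {x | t / 20 ≤ |u x|} := by
      ext x
      simp only [Set.mem_ofPred_eq]
      rw [sq_le_sq, abs_of_pos (by positivity : 0 < t / 20)]
    rw [hset] at h
    rw [le_div_iff₀ (by positivity)]
    linarith
  rw [Real.exp_neg, ← div_eq_mul_inv, le_div_iff₀ (Real.exp_pos _)]
  refine le_trans (mul_le_mul_of_nonneg_left (Real.exp_le_exp.2 ?_) measureReal_nonneg)
    (h1.trans h2)
  refine div_le_div_of_nonneg_right ?_ hD.le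
  nlinarith [sq_nonneg t]

theorem lintegral_rpow_mul_exp_sub_one_le {u : EuclideanSpace ℝ (Fin 2) → ℝ}
    (hu : ContDiff ℝ 1 u) (hlim : Tendsto u (cocompact _) (𝓝 0))
    (hu2 : Integrable fun x => u x ^ 2) (hdu : Integrable fun x => ‖fderiv ℝ u x‖ ^ 2)
    {D p κ β : ℝ} (hDdef : D = ∫ x, ‖fderiv ℝ u x‖ ^ 2) (hD : 0 < D) (hp : 0 < p) (hκ : 0 < κ)
    (hκD : κ * D ≤ 2 * Real.pi) (hβdef : β = 13 / 2 - 2 * Real.pi) :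
    ∫⁻ x, ENNReal.ofReal (|u x| ^ p * (Real.exp (κ * u x ^ 2) - 1)) ≤
      ENNReal.ofReal (200 * β ^ (-(p / 2)) * ((p + 2) * Real.Gamma (p / 2) +
        4 * Real.pi / β * Real.Gamma ((p + 2) / 2)) * κ * (∫ x, u x ^ 2) * D ^ (p / 2)) := by
  have hβ : 0 < β := by have := Real.pi_lt_d2; rw [hβdef]; linarith
  have huc : Continuous u := hu.continuous
  set N : ℝ := ∫ x, u x ^ 2 with hN
  have hN0 : 0 ≤ N := integral_nonneg fun x => sq_nonneg _
  set g : ℝ → ℝ := fun t => κ * (((p + 2) * t ^ (p + 1) + t ^ (p + 2) * (2 * κ * t)) *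
    Real.exp (κ * t ^ 2)) with hg
  have hgc : Continuous g := by
    have h1 : Continuous fun t : ℝ => t ^ (p + 1) :=
      Real.continuous_rpow_const (by linarith)
    have h2 : Continuous fun t : ℝ => t ^ (p + 2) :=
      Real.continuous_rpow_const (by linarith)
    rw [hg]
    fun_prop
  have hgint : ∀ s, ∫ t in (0 : ℝ)..s, g t = κ * (s ^ (p + 2) * Real.exp (κ * s ^ 2)) := by
    intro s
    have hd : ∀ t ∈ Set.uIcc 0 s,
        HasDerivAt (fun t => κ * (t ^ (p + 2) * Real.exp (κ * t ^ 2))) (g t) t := by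
      intro t _
      have h1 := Real.hasDerivAt_rpow_const (x := t) (p := p + 2) (Or.inr (by linarith))
      have h2 := (((hasDerivAt_id t).pow 2).const_mul κ).exp
      convert! (h1.mul h2).const_mul κ using 1
      simp only [hg, id, Pi.pow_apply, show p + 2 - 1 = p + 1 by ring]
      push_cast
      ring
    rw [intervalIntegral.integral_eq_sub_of_hasDerivAt hd (hgc.intervalIntegrable _ _),
      Real.zero_rpow (by linarith)]
    simp
  have hpt : ∀ x, |u x| ^ p * (Real.exp (κ * u x ^ 2) - 1) ≤ ∫ t in (0 : ℝ)..|u x|, g t := by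
    intro x
    have h1 : Real.exp (κ * u x ^ 2) - 1 ≤ κ * u x ^ 2 * Real.exp (κ * u x ^ 2) := by
      have := Real.add_one_le_exp (-(κ * u x ^ 2))
      have h2 : Real.exp (-(κ * u x ^ 2)) * Real.exp (κ * u x ^ 2) = 1 := by
        rw [← Real.exp_add]; simp
      nlinarith [Real.exp_pos (κ * u x ^ 2)]
    rw [hgint, sq_abs, Real.rpow_add_of_nonneg (abs_nonneg _) hp.le zero_le_two, Real.rpow_two,
      sq_abs]
    calc _ ≤ |u x| ^ p * (κ * u x ^ 2 * Real.exp (κ * u x ^ 2)) := by gcongr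
      _ = _ := by ring
  set h : ℝ → ℝ := fun t => 400 * N * κ * ((p + 2) * (t ^ (p - 1) * Real.exp (-(β / D) * t ^ 2)) +
    2 * κ * (t ^ (p + 1) * Real.exp (-(β / D) * t ^ 2))) with hh
  have hβD : 0 < β / D := by positivity
  have hi1 := integrableOn_rpow_mul_exp_neg_mul_sq hβD (s := p - 1) (by linarith)
  have hi2 := integrableOn_rpow_mul_exp_neg_mul_sq hβD (s := p + 1) (by linarith)
  have hhint : IntegrableOn h (Set.Ioi 0) :=
    ((hi1.const_mul (p + 2)).add (hi2.const_mul (2 * κ))).const_mul (400 * N * κ)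
  have hlevel : ∀ t ∈ Set.Ioi (0 : ℝ), volume {x | t ≤ |u x|} * ENNReal.ofReal (g t) ≤
      ENNReal.ofReal (h t) := by
    intro t ht
    rw [Set.mem_Ioi] at ht
    have hfin : volume {x | t ≤ |u x|} ≠ ⊤ := by
      refine ne_top_of_le_ne_top (hu2.measure_ge_lt_top (pow_pos ht 2)).ne
        (measure_mono fun x hx => ?_)
      simp only [Set.mem_ofPred_eq] at hx ⊢
      rw [← sq_abs (u x)]
      gcongr
    have hlev := measureReal_superlevel_le hu hlim hu2 hdu (hDdef ▸ hD) ht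
    rw [← hDdef, ← hN] at hlev
    have hg0 : 0 ≤ g t := by rw [hg]; positivity
    rw [← ofReal_measureReal hfin, ← ENNReal.ofReal_mul measureReal_nonneg]
    refine ENNReal.ofReal_le_ofReal ((mul_le_mul_of_nonneg_right hlev hg0).trans ?_)
    have hexp : Real.exp (-(13 / 2 * t ^ 2 / D)) * Real.exp (κ * t ^ 2) ≤
        Real.exp (-(β / D) * t ^ 2) := by
      rw [← Real.exp_add, Real.exp_le_exp]
      have h1 : κ ≤ 2 * Real.pi / D := by rwa [le_div_iff₀ hD]
      have h2 : -(13 / 2 * t ^ 2 / D) = -(β / D) * t ^ 2 - 2 * Real.pi / D * t ^ 2 := by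
        rw [hβdef]; ring
      rw [h2]
      nlinarith [sq_nonneg t]
    have e1 : t ^ (p + 1) = t ^ (p - 1) * t ^ 2 := by
      rw [← Real.rpow_two, ← Real.rpow_add ht]; congr 1; ring
    have e2 : t ^ (p + 2) = t ^ (p - 1) * t ^ 3 := by
      rw [← Real.rpow_natCast t 3, ← Real.rpow_add ht]; congr 1; push_cast; ring
    calc _ = 400 * N * κ * ((p + 2) * t ^ (p - 1) + 2 * κ * t ^ (p + 1)) *
          (Real.exp (-(13 / 2 * t ^ 2 / D)) * Real.exp (κ * t ^ 2)) := by
          simp only [hg]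
          rw [e1, e2]
          field_simp
      _ ≤ 400 * N * κ * ((p + 2) * t ^ (p - 1) + 2 * κ * t ^ (p + 1)) *
          Real.exp (-(β / D) * t ^ 2) := by gcongr
      _ = h t := by rw [hh]; ring
  have hval : ∀ s : ℝ, 0 < s → ∫ t in Set.Ioi (0 : ℝ), t ^ (s - 1) * Real.exp (-(β / D) * t ^ 2) =
      (β / D) ^ (-(s / 2)) * (1 / 2) * Real.Gamma (s / 2) := by
    intro s hs
    have := integral_rpow_mul_exp_neg_mul_rpow (p := 2) (q := s - 1) two_pos (by linarith) hβD
    simpa only [Real.rpow_two, sub_add_cancel, neg_div] using this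
  have hpow : (β / D) ^ (-(p / 2)) = β ^ (-(p / 2)) * D ^ (p / 2) := by
    rw [Real.div_rpow hβ.le hD.le, Real.rpow_neg hD.le, div_inv_eq_mul]
  have hpow' : (β / D) ^ (-((p + 2) / 2)) = β ^ (-(p / 2)) * D ^ (p / 2) * (D / β) := by
    rw [show -((p + 2) / 2) = -(p / 2) + -1 by ring, Real.rpow_add hβD, hpow, Real.rpow_neg_one,
      inv_div]
  calc ∫⁻ x, ENNReal.ofReal (|u x| ^ p * (Real.exp (κ * u x ^ 2) - 1))
      ≤ ∫⁻ x, ENNReal.ofReal (∫ t in (0 : ℝ)..|u x|, g t) :=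
        lintegral_mono fun x => ENNReal.ofReal_le_ofReal (hpt x)
    _ = ∫⁻ t in Set.Ioi 0, volume {x | t ≤ |u x|} * ENNReal.ofReal (g t) := by
        refine lintegral_comp_eq_lintegral_meas_le_mul volume
          (Eventually.of_forall fun x => abs_nonneg _) huc.abs.measurable.aemeasurable
          (fun t _ => hgc.intervalIntegrable _ _) ?_
        filter_upwards [ae_restrict_mem measurableSet_Ioi] with t ht
        rw [Set.mem_Ioi] at ht
        rw [hg]
        positivity
    _ ≤ ∫⁻ t in Set.Ioi 0, ENNReal.ofReal (h t) := setLIntegral_mono' measurableSet_Ioi hlevel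
    _ = ENNReal.ofReal (∫ t in Set.Ioi 0, h t) := by
        refine (ofReal_integral_eq_lintegral_ofReal hhint ?_).symm
        filter_upwards [ae_restrict_mem measurableSet_Ioi] with t ht
        rw [Set.mem_Ioi] at ht
        rw [hh]
        positivity
    _ ≤ _ := by
        refine ENNReal.ofReal_le_ofReal ?_
        have e := hval (p + 2) (by linarith)
        rw [show p + 2 - 1 = p + 1 by ring] at e
        rw [hh, integral_const_mul, integral_add (hi1.const_mul _) (hi2.const_mul _),
          integral_const_mul, integral_const_mul, hval p hp, e, hpow, hpow']
        have hG : 0 < Real.Gamma ((p + 2) / 2) := Real.Gamma_pos_of_pos (by linarith)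
        have hc : 2 * κ * (D / β) ≤ 4 * Real.pi / β := by
          rw [← mul_div_assoc]
          refine div_le_div_of_nonneg_right ?_ hβ.le
          linarith
        calc _ = 200 * N * κ * (β ^ (-(p / 2)) * D ^ (p / 2)) * ((p + 2) * Real.Gamma (p / 2) +
              2 * κ * (D / β) * Real.Gamma ((p + 2) / 2)) := by ring
          _ ≤ 200 * N * κ * (β ^ (-(p / 2)) * D ^ (p / 2)) * ((p + 2) * Real.Gamma (p / 2) +
              4 * Real.pi / β * Real.Gamma ((p + 2) / 2)) := by gcongr
          _ = _ := by ring

theorem stmt6 (p κ q : ℝ) (hp : 2 < p) (hκ : 0 < κ) (hq : 1 < q)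
    (hpq : (4 - p) * q < 2) :
    ∃ C > 0, ∀ φ : SchwartzMap (EuclideanSpace ℝ (Fin 2)) ℝ,
      q * κ * (∫ x, ‖fderiv ℝ (⇑φ) x‖^2) ≤ 2 * Real.pi →
      (∫ x, |φ x| ^ p * (Real.exp (κ * (φ x)^2) - 1)) ≤
        C * (∫ x, (φ x)^2) * (∫ x, ‖fderiv ℝ (⇑φ) x‖^2) ^ ((p - 2/(q/(q-1)))/2) := by
  obtain ⟨β, hβdef⟩ : ∃ β, β = 13 / 2 - 2 * Real.pi := ⟨_, rfl⟩
  have hβ : 0 < β := by have := Real.pi_lt_d2; rw [hβdef]; linarith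
  have hp0 : 0 < p := by linarith
  have hG : 0 < Real.Gamma (p / 2) := Real.Gamma_pos_of_pos (by linarith)
  have hG' : 0 < Real.Gamma ((p + 2) / 2) := Real.Gamma_pos_of_pos (by linarith)
  set A : ℝ := 200 * β ^ (-(p / 2)) * ((p + 2) * Real.Gamma (p / 2) +
        4 * Real.pi / β * Real.Gamma ((p + 2) / 2)) * κ with hA
  have hA0 : 0 < A := by positivity
  refine ⟨A * (2 * Real.pi / (q * κ)) ^ ((q - 1) / q), by positivity, fun φ hφ => ?_⟩
  have hu : ContDiff ℝ 1 φ := φ.smooth 1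
  have hlim : Tendsto φ (cocompact _) (𝓝 0) := zero_at_infty φ
  have hu2 : Integrable fun x => φ x ^ 2 := (φ.memLp 2).integrable_sq
  have hdu : Integrable fun x => ‖fderiv ℝ φ x‖ ^ 2 := by
    simpa only [SchwartzMap.fderivCLM_apply] using
      ((SchwartzMap.fderivCLM ℝ _ ℝ φ).memLp 2 volume).integrable_norm_pow two_ne_zero
  obtain ⟨D, hDdef⟩ : ∃ D, D = ∫ x, ‖fderiv ℝ φ x‖ ^ 2 := ⟨_, rfl⟩
  have hD0 : 0 ≤ D := hDdef ▸ integral_nonneg fun x => by positivity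
  have hN0 : 0 ≤ ∫ x, φ x ^ 2 := integral_nonneg fun x => sq_nonneg _
  rw [← hDdef] at hφ ⊢
  rcases hD0.eq_or_lt with hD | hD
  · have hz : (fun x => ‖fderiv ℝ φ x‖ ^ 2) =ᵐ[volume] 0 :=
      (integral_eq_zero_iff_of_nonneg (fun x => by positivity) hdu).1 (hD.trans hDdef).symm
    have h1 : ∫⁻ x, ‖fderiv ℝ φ x‖ₑ = 0 := by
      rw [lintegral_eq_zero_iff (hu.continuous_fderiv one_ne_zero).enorm.measurable]
      filter_upwards [hz] with x hx
      have hx' : fderiv ℝ φ x = 0 := by simpa using hx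
      rw [hx']
      exact enorm_zero (E := EuclideanSpace ℝ (Fin 2) →L[ℝ] ℝ)
    have h2 := eight_mul_lintegral_enorm_sq_le hu hlim
    rw [h1, zero_pow two_ne_zero, nonpos_iff_eq_zero, mul_eq_zero,
      or_iff_right (by norm_num),
      lintegral_eq_zero_iff (hu.continuous.enorm.measurable.pow_const 2)] at h2
    have h3 : ∫ x, |φ x| ^ p * (Real.exp (κ * (φ x)^2) - 1) = 0 := by
      refine integral_eq_zero_of_ae ?_
      filter_upwards [h2] with x hx
      have : φ x = 0 := by simpa using hx
      simp [this]
    rw [h3]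
    positivity
  · have hκD : κ * D ≤ 2 * Real.pi := by nlinarith [mul_pos hκ hD]
    have hmain := lintegral_rpow_mul_exp_sub_one_le hu hlim hu2 hdu hDdef hD hp0 hκ hκD hβdef
    rw [← hA] at hmain
    have hcont : Continuous fun x => |φ x| ^ p * (Real.exp (κ * (φ x)^2) - 1) := by
      have h1 := hu.continuous
      exact (h1.abs.rpow_const fun _ => Or.inr hp0.le).mul (by fun_prop)
    rw [integral_eq_lintegral_of_nonneg_ae
      (Eventually.of_forall fun x => mul_nonneg (by positivity)
        (sub_nonneg.2 (Real.one_le_exp (by positivity)))) hcont.aestronglyMeasurable]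
    refine (ENNReal.toReal_le_of_le_ofReal (by positivity) hmain).trans ?_
    have hDle : D ≤ 2 * Real.pi / (q * κ) := by
      rw [le_div_iff₀ (by positivity)]
      linarith
    have hsplit : D ^ (p / 2) = D ^ ((q - 1) / q) * D ^ ((p - 2/(q/(q-1)))/2) := by
      rw [← Real.rpow_add hD]
      congr 1
      have : q - 1 ≠ 0 := by linarith
      field_simp
      ring
    have hle : D ^ ((q - 1) / q) ≤ (2 * Real.pi / (q * κ)) ^ ((q - 1) / q) :=
      Real.rpow_le_rpow hD0 hDle (div_nonneg (by linarith) (by linarith))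
    calc _ = A * D ^ ((q - 1) / q) * (∫ x, φ x ^ 2) * D ^ ((p - 2/(q/(q-1)))/2) := by
          rw [hsplit]; ring
      _ ≤ _ := by gcongr
end

section
/- Let d ≥ 2 be an integer, let (α,β) ∈ ℝ² be admissible with (d,α) ≠ (2,0), and let f : ℝ → ℝ be differentiable with subcritical growth. Then for every A > 0 there exists δ > 0 such that every real-valued Schwartz function φ ≢ 0 on ℝ^d with ∫_{ℝ^d}φ² dx + ∫_{ℝ^d}|∇φ|² dx ≤ A and K^Q_{α,β}(φ) ≤ δ satisfies K_{α,β}(φ) > 0. -/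
open MeasureTheory Module Filter Topology
open scoped ENNReal NNReal

/-- The Gagliardo–Nirenberg–Sobolev inequality for `C¹` functions in `L^p`, without any assumption
of compact support. -/
theorem eLpNorm_le_eLpNorm_fderiv_of_eq_inner_of_memLp {E F : Type*}
    [NormedAddCommGroup E] [NormedSpace ℝ E] [FiniteDimensional ℝ E] [MeasurableSpace E]
    [BorelSpace E] (μ : Measure E) [μ.IsAddHaarMeasure]
    [NormedAddCommGroup F] [InnerProductSpace ℝ F] {u : E → F} (hu : ContDiff ℝ 1 u)
    {p p' : ℝ≥0} (hup : MemLp u p μ) (hp : 1 ≤ p) (hn : 0 < finrank ℝ E)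
    (hp' : (p' : ℝ)⁻¹ = p⁻¹ - (finrank ℝ E : ℝ)⁻¹) :
    eLpNorm u p' μ ≤ eLpNormLESNormFDerivOfEqInnerConst μ p * eLpNorm (fderiv ℝ u) p μ := by
  set K : ℝ≥0 := eLpNormLESNormFDerivOfEqInnerConst μ p
  let χ : ContDiffBump (0 : E) := ⟨1, 2, one_pos, one_lt_two⟩
  obtain ⟨B, hB⟩ : ∃ B : ℝ, ∀ x, ‖fderiv ℝ χ x‖ ≤ B :=
    (χ.hasCompactSupport.fderiv ℝ).exists_bound_of_continuous
      ((χ.contDiff (n := 1)).continuous_fderiv one_ne_zero)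
  have hB0 : 0 ≤ B := (norm_nonneg _).trans (hB 0)
  let c : ℕ → ℝ := fun n => 1 / ((n : ℝ) + 1)
  have hc : ∀ n, 0 < c n := fun n => by positivity
  have hc0 : Tendsto c atTop (𝓝 0) := tendsto_one_div_add_atTop_nhds_zero_nat
  let v : ℕ → E → F := fun n x => χ (c n • x) • u x
  have hχ : ∀ n, ContDiff ℝ 1 fun x => χ (c n • x) := fun n =>
    χ.contDiff.comp (contDiff_const_smul (c n))
  have hv : ∀ n, ContDiff ℝ 1 (v n) := fun n => (hχ n).smul hu
  have hvc : ∀ n, HasCompactSupport (v n) := fun n =>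
    (χ.hasCompactSupport.comp_homeomorph (Homeomorph.smulOfNeZero (c n) (hc n).ne')).smul_right
  have hfderiv : ∀ n x, ‖fderiv ℝ (v n) x‖ ≤ ‖fderiv ℝ u x‖ + c n * B * ‖u x‖ := by
    intro n x
    have h1 : fderiv ℝ (v n) x = _ :=
      fderiv_fun_smul ((hχ n).differentiable one_ne_zero x) (hu.differentiable one_ne_zero x)
    have h2 : fderiv ℝ (fun x => χ (c n • x)) x = c n • fderiv ℝ χ (c n • x) :=
      fderiv_comp_smul (c n)
    rw [h1, h2]
    refine (norm_add_le _ _).trans (add_le_add ?_ ?_)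
    · rw [norm_smul, Real.norm_of_nonneg χ.nonneg]
      exact mul_le_of_le_one_left (norm_nonneg _) χ.le_one
    · rw [ContinuousLinearMap.norm_smulRight_apply, norm_smul, Real.norm_of_nonneg (hc n).le]
      gcongr
      exact hB _
  have hbound : ∀ n, eLpNorm (v n) p' μ ≤
      K * (eLpNorm (fderiv ℝ u) p μ + ENNReal.ofReal (c n * B) * eLpNorm u p μ) := by
    intro n
    refine (eLpNorm_le_eLpNorm_fderiv_of_eq_inner μ (hv n) (hvc n) hp hn hp').trans ?_
    gcongr
    refine (eLpNorm_mono_real (hfderiv n)).trans ?_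
    refine (eLpNorm_add_le (f := fun x => ‖fderiv ℝ u x‖) (g := fun x => c n * B * ‖u x‖)
      (hu.continuous_fderiv one_ne_zero).norm.aestronglyMeasurable
      (by have := hu.continuous; fun_prop) (by exact_mod_cast hp)).trans ?_
    rw [eLpNorm_norm]
    gcongr
    refine (eLpNorm_const_smul_le (c := c n * B) (f := fun x => ‖u x‖)).trans ?_
    rw [eLpNorm_norm, Real.enorm_of_nonneg (mul_nonneg (hc n).le hB0)]
  have hlim : Tendsto (fun n => K * (eLpNorm (fderiv ℝ u) p μ
      + ENNReal.ofReal (c n * B) * eLpNorm u p μ)) atTop (𝓝 (K * eLpNorm (fderiv ℝ u) p μ)) := by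
    refine ENNReal.Tendsto.const_mul ?_ (Or.inr ENNReal.coe_ne_top)
    have h : Tendsto (fun n => ENNReal.ofReal (c n * B)) atTop (𝓝 0) := by
      simpa using ENNReal.tendsto_ofReal (hc0.mul_const B)
    simpa using (ENNReal.Tendsto.mul_const h (Or.inr hup.eLpNorm_ne_top)).const_add
      (eLpNorm (fderiv ℝ u) p μ)
  refine (Lp.eLpNorm_lim_le_liminf_eLpNorm
    (fun n => (hv n).continuous.aestronglyMeasurable) u (ae_of_all _ fun x => ?_)).trans
    ((liminf_le_liminf (Eventually.of_forall hbound)).trans hlim.liminf_eq.le)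
  have h : Tendsto (fun n => c n • x) atTop (𝓝 0) := by simpa using hc0.smul_const x
  have h1 : Tendsto (fun n => χ (c n • x)) atTop (𝓝 (χ 0)) :=
    (χ.contDiff (n := 1)).continuous.continuousAt.tendsto.comp h
  rw [χ.one_of_mem_closedBall (by simp [χ.rIn_pos.le])] at h1
  simpa using h1.smul_const (u x)

/-- Log-convexity in the exponent of `∫ |u|^p`. -/
theorem lintegral_enorm_rpow_le_interpolation {X F : Type*} [MeasurableSpace X] {μ : Measure X}
    [NormedAddCommGroup F] {u : X → F} (hu : AEStronglyMeasurable u μ) {p q r s t : ℝ}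
    (hp : 0 ≤ p) (hr : 0 ≤ r) (hs : 0 ≤ s) (ht : 0 ≤ t) (hst : s + t = 1)
    (hq : s * p + t * r = q) :
    ∫⁻ x, ‖u x‖ₑ ^ q ∂μ ≤ (∫⁻ x, ‖u x‖ₑ ^ p ∂μ) ^ s * (∫⁻ x, ‖u x‖ₑ ^ r ∂μ) ^ t := by
  refine le_trans (le_of_eq ?_) (ENNReal.lintegral_mul_norm_pow_le
    (hu.enorm.pow_const p) (hu.enorm.pow_const r) hs ht hst)
  refine lintegral_congr fun x => ?_
  rw [← ENNReal.rpow_mul, ← ENNReal.rpow_mul,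
    ← ENNReal.rpow_add_of_nonneg _ _ (by positivity) (by positivity), ← hq]
  ring_nf

/-- Sobolev's inequality for the critical power, in integral form. -/
theorem SchwartzMap.lintegral_rpow_le_lintegral_fderiv_rpow {d : ℕ} (hd : 3 ≤ d) :
    ∃ K : ℝ≥0, ∀ φ : SchwartzMap (EuclideanSpace ℝ (Fin d)) ℝ,
      ∫⁻ x, ‖φ x‖ₑ ^ (2 * d / (d - 2) : ℝ) ≤
        K * (∫⁻ x, ‖fderiv ℝ φ x‖ₑ ^ (2 : ℝ)) ^ (d / (d - 2) : ℝ) := by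
  have hd3 : (3 : ℝ) ≤ d := by exact_mod_cast hd
  have hd2 : (0 : ℝ) < d - 2 := by linarith
  set p' : ℝ≥0 := (2 * d / (d - 2) : ℝ).toNNReal with hp'
  have hp'c : (p' : ℝ) = 2 * d / (d - 2) := Real.coe_toNNReal _ (by positivity)
  have hp'0 : p' ≠ 0 := by
    rw [← NNReal.coe_ne_zero, hp'c]; positivity
  set K := eLpNormLESNormFDerivOfEqInnerConst (volume : Measure (EuclideanSpace ℝ (Fin d)))
    ((2 : ℝ≥0) : ℝ)
  refine ⟨K ^ (p' : ℝ), fun φ => ?_⟩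
  have h := eLpNorm_le_eLpNorm_fderiv_of_eq_inner_of_memLp volume (φ.smooth 1)
    (φ.memLp _) (p := 2) (p' := p') one_le_two (by simp; omega) (by
      rw [hp'c, finrank_euclideanSpace_fin]; push_cast; field_simp)
  have h2 := ENNReal.rpow_le_rpow h p'.coe_nonneg
  rw [eLpNorm_nnreal_pow_eq_lintegral hp'0, ENNReal.mul_rpow_of_nonneg _ _ p'.coe_nonneg,
    eLpNorm_nnreal_eq_lintegral two_ne_zero, ← ENNReal.rpow_mul,
    ← ENNReal.coe_rpow_of_nonneg _ p'.coe_nonneg, hp'c] at h2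
  rw [hp'c]
  convert h2 using 3
  · simp only [NNReal.coe_ofNat]
  · rw [NNReal.coe_ofNat]
    field_simp

/-- Ladyzhenskaya-type inequality in the plane: raising the exponent by two gains one factor of the
Dirichlet energy. -/
theorem SchwartzMap.lintegral_rpow_le_mul_lintegral_rpow_sub_two (k : ℕ) :
    ∃ K : ℝ≥0, ∀ φ : SchwartzMap (EuclideanSpace ℝ (Fin 2)) ℝ,
      ∫⁻ x, ‖φ x‖ₑ ^ (2 * (k + 2 : ℝ)) ≤
        K * (∫⁻ x, ‖fderiv ℝ φ x‖ₑ ^ (2 : ℝ)) * ∫⁻ x, ‖φ x‖ₑ ^ (2 * (k + 1 : ℝ)) := by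
  set K := eLpNormLESNormFDerivOfEqInnerConst (volume : Measure (EuclideanSpace ℝ (Fin 2)))
    ((1 : ℝ≥0) : ℝ)
  refine ⟨(K * (k + 2)) ^ 2, fun φ => ?_⟩
  have hφ := φ.continuous
  have hφ' := (φ.smooth 1).continuous_fderiv one_ne_zero
  have hmem : MemLp (fun x => φ x ^ (k + 2)) 1 volume := by
    rw [memLp_one_iff_integrable, ← integrable_norm_iff (by fun_prop)]
    convert! (φ.memLp ((k + 2 : ℕ) : ℝ≥0∞) volume).integrable_norm_rpow
      (by simp) (ENNReal.natCast_ne_top _) using 2 with x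
    rw [ENNReal.toReal_natCast, Real.rpow_natCast, norm_pow]
  have h := eLpNorm_le_eLpNorm_fderiv_of_eq_inner_of_memLp volume
    (u := fun x => φ x ^ (k + 2)) ((φ.smooth 1).pow _) (p := 1) (p' := 2) (by simpa using hmem)
    le_rfl (by simp) (by norm_num)
  have hgrad : ∫⁻ x, ‖fderiv ℝ (fun x => φ x ^ (k + 2)) x‖ₑ ≤ ((k + 2 : ℝ≥0) : ℝ≥0∞) *
      ((∫⁻ x, ‖φ x‖ₑ ^ (2 * (k + 1 : ℝ))) ^ (1 / 2 : ℝ) *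
        (∫⁻ x, ‖fderiv ℝ φ x‖ₑ ^ (2 : ℝ)) ^ (1 / 2 : ℝ)) := by
    calc ∫⁻ x, ‖fderiv ℝ (fun x => φ x ^ (k + 2)) x‖ₑ
        = ∫⁻ x, ((k + 2 : ℝ≥0) : ℝ≥0∞) * ((‖φ x‖ₑ ^ (2 * (k + 1 : ℝ))) ^ (1 / 2 : ℝ) *
            (‖fderiv ℝ φ x‖ₑ ^ (2 : ℝ)) ^ (1 / 2 : ℝ)) := by
          refine lintegral_congr fun x => ?_
          have hk : 2 * (k + 1 : ℝ) * (1 / 2) = ((k + 1 : ℕ) : ℝ) := by push_cast; ring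
          have hk2 : ((k + 2 : ℕ) : ℝ) = ((k + 2 : ℝ≥0) : ℝ) := by push_cast; rfl
          rw [fderiv_fun_pow (k + 2) φ.differentiableAt, ← ENNReal.rpow_mul, ← ENNReal.rpow_mul,
            hk, ENNReal.rpow_natCast]
          simp only [enorm_smul, enorm_mul, enorm_pow, nsmul_eq_mul, mul_one_div_cancel,
            ENNReal.rpow_one, ne_eq, OfNat.ofNat_ne_zero, not_false_eq_true, ← mul_assoc]
          congr 2
          rw [hk2, Real.enorm_of_nonneg (NNReal.coe_nonneg _), ENNReal.ofReal_coe_nnreal]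
      _ = ((k + 2 : ℝ≥0) : ℝ≥0∞) * ∫⁻ x, (‖φ x‖ₑ ^ (2 * (k + 1 : ℝ))) ^ (1 / 2 : ℝ) *
            (‖fderiv ℝ φ x‖ₑ ^ (2 : ℝ)) ^ (1 / 2 : ℝ) :=
          lintegral_const_mul' _ _ ENNReal.coe_ne_top
      _ ≤ _ := by
          gcongr
          exact ENNReal.lintegral_mul_norm_pow_le
            (hφ.aestronglyMeasurable.enorm.pow_const _)
            (hφ'.aestronglyMeasurable.enorm.pow_const _) (by norm_num) (by norm_num) (by norm_num)
  have h2 := ENNReal.rpow_le_rpow h zero_le_two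
  have h3 := eLpNorm_nnreal_pow_eq_lintegral (μ := volume) (f := fun x => φ x ^ (k + 2))
    (two_ne_zero (α := ℝ≥0))
  rw [NNReal.coe_ofNat] at h3
  rw [h3, ENNReal.coe_one, eLpNorm_one_eq_lintegral_enorm] at h2
  calc ∫⁻ x, ‖φ x‖ₑ ^ (2 * (k + 2 : ℝ)) = ∫⁻ x, ‖φ x ^ (k + 2)‖ₑ ^ (2 : ℝ) := by
        refine lintegral_congr fun x => ?_
        rw [enorm_pow, ← ENNReal.rpow_natCast, ← ENNReal.rpow_mul]
        push_cast
        ring_nf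
    _ ≤ (K * (((k + 2 : ℝ≥0) : ℝ≥0∞) * ((∫⁻ x, ‖φ x‖ₑ ^ (2 * (k + 1 : ℝ))) ^ (1 / 2 : ℝ) *
        (∫⁻ x, ‖fderiv ℝ φ x‖ₑ ^ (2 : ℝ)) ^ (1 / 2 : ℝ)))) ^ (2 : ℝ) :=
        h2.trans (by gcongr)
    _ = _ := by
        simp only [ENNReal.mul_rpow_of_nonneg _ _ zero_le_two, ← ENNReal.rpow_mul]
        norm_num
        ring

/-- The Gagliardo–Nirenberg inequality in the plane for even exponents. -/
theorem SchwartzMap.lintegral_rpow_even_le (k : ℕ) :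
    ∃ K : ℝ≥0, ∀ φ : SchwartzMap (EuclideanSpace ℝ (Fin 2)) ℝ,
      ∫⁻ x, ‖φ x‖ₑ ^ (2 * (k + 1 : ℝ)) ≤
        K * (∫⁻ x, ‖fderiv ℝ φ x‖ₑ ^ (2 : ℝ)) ^ (k : ℝ) * ∫⁻ x, ‖φ x‖ₑ ^ (2 : ℝ) := by
  induction k with
  | zero => exact ⟨1, fun φ => by simp⟩
  | succ k ih =>
    obtain ⟨K, hK⟩ := ih
    obtain ⟨L, hL⟩ := SchwartzMap.lintegral_rpow_le_mul_lintegral_rpow_sub_two k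
    refine ⟨L * K, fun φ => ?_⟩
    have hk : 2 * (((k + 1 : ℕ) : ℝ) + 1) = 2 * (k + 2 : ℝ) := by push_cast; ring
    rw [hk]
    refine (hL φ).trans ((mul_le_mul_right (hK φ) _).trans_eq ?_)
    simp only [ENNReal.rpow_natCast, pow_succ, ENNReal.coe_mul]
    ring

/-- Two Gagliardo–Nirenberg estimates: at the mass-critical exponent, and at some exponent above
any given admissible one. -/
theorem SchwartzMap.exists_lintegral_rpow_le_endpoints {d : ℕ} (hd : 2 ≤ d) {q : ℝ}
    (hq : 3 ≤ d → q ≤ 2 + 4 / ((d : ℝ) - 2)) (A : ℝ≥0) :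
    ∃ (K L : ℝ≥0) (r θ : ℝ), q ≤ r ∧ 0 < θ ∧ ∀ φ : SchwartzMap (EuclideanSpace ℝ (Fin d)) ℝ,
      ∫⁻ x, ‖φ x‖ₑ ^ (2 : ℝ) ≤ A →
      ∫⁻ x, ‖φ x‖ₑ ^ (2 + 4 / d : ℝ) ≤ K * ∫⁻ x, ‖fderiv ℝ φ x‖ₑ ^ (2 : ℝ) ∧
      ∫⁻ x, ‖φ x‖ₑ ^ r ≤ L * (∫⁻ x, ‖fderiv ℝ φ x‖ₑ ^ (2 : ℝ)) ^ (1 + θ) := by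
  obtain rfl | hd := hd.eq_or_lt
  · obtain ⟨n, hn⟩ := exists_nat_ge q
    obtain ⟨K, hK⟩ := SchwartzMap.lintegral_rpow_even_le 1
    obtain ⟨L, hL⟩ := SchwartzMap.lintegral_rpow_even_le (n + 2)
    refine ⟨K * A, L * A, 2 * (((n + 2 : ℕ) : ℝ) + 1), n + 1, ?_, by positivity,
      fun φ hφ => ⟨?_, ?_⟩⟩
    · push_cast
      linarith [n.cast_nonneg (α := ℝ)]
    · have h := (hK φ).trans (mul_le_mul_right hφ _)
      norm_num at h ⊢
      exact h.trans_eq (by ring)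
    · have hn : (1 + (n + 1) : ℝ) = ((n + 2 : ℕ) : ℝ) := by push_cast; ring
      rw [hn, ENNReal.coe_mul]
      exact ((hL φ).trans (mul_le_mul_right hφ _)).trans_eq (by ring)
  · have hd3 : (3 : ℝ) ≤ d := by exact_mod_cast hd
    have hd2 : (0 : ℝ) < d - 2 := by linarith
    obtain ⟨L, hL⟩ := SchwartzMap.lintegral_rpow_le_lintegral_fderiv_rpow (d := d) hd
    refine ⟨A ^ (2 / d : ℝ) * L ^ ((d - 2) / d : ℝ), L, 2 * d / (d - 2), 2 / (d - 2),
      (hq hd).trans_eq (by field_simp; ring), by positivity, fun φ hφ => ⟨?_, ?_⟩⟩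
    · have hs : (0 : ℝ) ≤ 2 / d := by positivity
      have ht : (0 : ℝ) ≤ (d - 2) / d := by positivity
      refine (lintegral_enorm_rpow_le_interpolation (p := 2) (r := 2 * d / (d - 2))
        φ.continuous.aestronglyMeasurable zero_le_two (by positivity) hs ht
        (by field_simp; ring) (by field_simp; ring)).trans ?_
      refine (mul_le_mul' (ENNReal.rpow_le_rpow hφ hs)
        (ENNReal.rpow_le_rpow (hL φ) ht)).trans_eq ?_
      rw [ENNReal.mul_rpow_of_nonneg _ _ ht, ← ENNReal.rpow_mul, ENNReal.coe_mul,
        ENNReal.coe_rpow_of_nonneg _ hs, ENNReal.coe_rpow_of_nonneg _ ht,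
        show (d / (d - 2) : ℝ) * ((d - 2) / d) = 1 by field_simp, ENNReal.rpow_one, mul_assoc]
    · convert hL φ using 3
      field_simp
      ring

/-- The `L^q` norm is superlinear in the Dirichlet energy for mass-supercritical `q`. -/
theorem SchwartzMap.exists_lintegral_rpow_le_superlinear {d : ℕ} (hd : 2 ≤ d) {q : ℝ}
    (hq0 : 2 + 4 / (d : ℝ) < q) (hq : 3 ≤ d → q ≤ 2 + 4 / ((d : ℝ) - 2)) (A : ℝ≥0) :
    ∃ K : ℝ≥0, ∃ θ > 0, ∀ φ : SchwartzMap (EuclideanSpace ℝ (Fin d)) ℝ,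
      ∫⁻ x, ‖φ x‖ₑ ^ (2 : ℝ) ≤ A →
      ∫⁻ x, ‖φ x‖ₑ ^ q ≤ K * (∫⁻ x, ‖fderiv ℝ φ x‖ₑ ^ (2 : ℝ)) ^ (1 + θ : ℝ) := by
  obtain ⟨K, L, r, θ, hr, hθ, h⟩ := SchwartzMap.exists_lintegral_rpow_le_endpoints hd hq A
  have hp : (0 : ℝ) ≤ 2 + 4 / d := by positivity
  set p : ℝ := 2 + 4 / d
  set t : ℝ := (q - p) / (r - p)
  have ht : 0 < t := div_pos (by linarith) (by linarith)
  have ht1 : 0 ≤ 1 - t := sub_nonneg.2 (div_le_one_of_le₀ (by linarith) (by linarith))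
  have htr : t * (r - p) = q - p := div_mul_cancel₀ _ (by linarith)
  refine ⟨K ^ (1 - t) * L ^ t, t * θ, mul_pos ht hθ, fun φ hφ => ?_⟩
  obtain ⟨h1, h2⟩ := h φ hφ
  refine (lintegral_enorm_rpow_le_interpolation (p := p) (r := r) (s := 1 - t) (t := t)
    φ.continuous.aestronglyMeasurable hp (by linarith) ht1 ht.le (by ring)
    (by linear_combination htr)).trans ?_
  refine (mul_le_mul' (ENNReal.rpow_le_rpow h1 ht1) (ENNReal.rpow_le_rpow h2 ht.le)).trans_eq ?_
  rw [ENNReal.mul_rpow_of_nonneg _ _ ht1, ENNReal.mul_rpow_of_nonneg _ _ ht.le,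
    ← ENNReal.rpow_mul, mul_mul_mul_comm, ← ENNReal.rpow_add_of_nonneg _ _ ht1 (by positivity),
    ENNReal.coe_mul, ENNReal.coe_rpow_of_nonneg _ ht1, ENNReal.coe_rpow_of_nonneg _ ht.le]
  ring_nf

theorem SchwartzMap.integrable_norm_rpow {E F : Type*} [NormedAddCommGroup E] [NormedSpace ℝ E]
    [NormedAddCommGroup F] [NormedSpace ℝ F] [MeasurableSpace E] [BorelSpace E]
    [SecondCountableTopology E] (μ : Measure E) [μ.HasTemperateGrowth]
    (φ : SchwartzMap E F) {q : ℝ} (hq : 0 < q) : Integrable (fun x => ‖φ x‖ ^ q) μ := by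
  simpa [hq.le] using (φ.memLp (ENNReal.ofReal q) μ).integrable_norm_rpow
    (by simpa using hq) ENNReal.ofReal_ne_top

theorem SchwartzMap.lintegral_enorm_rpow_eq {E F : Type*} [NormedAddCommGroup E] [NormedSpace ℝ E]
    [NormedAddCommGroup F] [NormedSpace ℝ F] [MeasurableSpace E] [BorelSpace E]
    [SecondCountableTopology E] (μ : Measure E) [μ.HasTemperateGrowth]
    (φ : SchwartzMap E F) {q : ℝ} (hq : 0 < q) :
    ∫⁻ x, ‖φ x‖ₑ ^ q ∂μ = ENNReal.ofReal (∫ x, ‖φ x‖ ^ q ∂μ) := by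
  rw [ofReal_integral_eq_lintegral_ofReal (φ.integrable_norm_rpow μ hq)
    (ae_of_all _ fun x => by positivity)]
  refine lintegral_congr fun x => ?_
  rw [← ENNReal.ofReal_rpow_of_nonneg (norm_nonneg _) hq.le, ofReal_norm]

theorem SchwartzMap.exists_integral_rpow_le_superlinear {d : ℕ} (hd : 2 ≤ d) {q : ℝ}
    (hq0 : 2 + 4 / (d : ℝ) < q) (hq : 3 ≤ d → q ≤ 2 + 4 / ((d : ℝ) - 2)) (A : ℝ) :
    ∃ K : ℝ≥0, ∃ θ > 0, ∀ φ : SchwartzMap (EuclideanSpace ℝ (Fin d)) ℝ,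
      ∫ x, φ x ^ 2 ≤ A →
      ∫ x, |φ x| ^ q ≤ K * (∫ x, ‖fderiv ℝ φ x‖ ^ 2) ^ (1 + θ : ℝ) := by
  obtain ⟨K, θ, hθ, h⟩ := SchwartzMap.exists_lintegral_rpow_le_superlinear hd hq0 hq A.toNNReal
  refine ⟨K, θ, hθ, fun φ hφ => ?_⟩
  have hq' : 0 < q := lt_trans (by positivity) hq0
  have hM : ∫⁻ x, ‖φ x‖ₑ ^ (2 : ℝ) ≤ A.toNNReal := by
    rw [φ.lintegral_enorm_rpow_eq volume two_pos]
    simp only [Real.rpow_two, Real.norm_eq_abs, sq_abs]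
    exact ENNReal.ofReal_le_ofReal hφ
  have h1 := h φ hM
  have h2 := (SchwartzMap.fderivCLM ℝ _ _ φ).lintegral_enorm_rpow_eq volume (two_pos (α := ℝ))
  simp only [SchwartzMap.fderivCLM_apply, Real.rpow_two] at h2
  have hG : 0 ≤ ∫ x, ‖fderiv ℝ φ x‖ ^ 2 := integral_nonneg fun x => by positivity
  rw [h2, φ.lintegral_enorm_rpow_eq volume hq', ENNReal.ofReal_rpow_of_nonneg hG (by positivity),
    ← ENNReal.ofReal_coe_nnreal, ← ENNReal.ofReal_mul K.coe_nonneg,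
    ENNReal.ofReal_le_ofReal_iff (by positivity)] at h1
  exact h1

/-- A nonzero Schwartz function has positive Dirichlet energy. -/
theorem SchwartzMap.integral_norm_fderiv_sq_pos {d : ℕ} (hd : 2 ≤ d)
    {φ : SchwartzMap (EuclideanSpace ℝ (Fin d)) ℝ} (hφ : φ ≠ 0) :
    0 < ∫ x, ‖fderiv ℝ φ x‖ ^ 2 := by
  refine (integral_nonneg fun x => by positivity).lt_of_ne' fun h0 => hφ ?_
  have hq0 : 2 + 4 / (d : ℝ) < 2 + 4 / (d - 1) := by
    have : (2 : ℝ) ≤ d := by exact_mod_cast hd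
    gcongr <;> linarith
  have hq : 3 ≤ d → 2 + 4 / ((d : ℝ) - 1) ≤ 2 + 4 / ((d : ℝ) - 2) := fun h => by
    have : (3 : ℝ) ≤ d := by exact_mod_cast h
    gcongr <;> linarith
  have hq' : 0 < 2 + 4 / ((d : ℝ) - 1) := lt_trans (by positivity) hq0
  obtain ⟨K, θ, hθ, h⟩ := SchwartzMap.exists_integral_rpow_le_superlinear hd hq0 hq
    (∫ x, φ x ^ 2)
  have h1 := h φ le_rfl
  rw [h0, Real.zero_rpow (by positivity), mul_zero] at h1
  have h2 := (integral_eq_zero_iff_of_nonneg (fun x => by positivity)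
    (φ.integrable_norm_rpow volume hq')).1 (h1.antisymm (integral_nonneg fun x => by positivity))
  have h3 := (Continuous.ae_eq_iff_eq volume (φ.continuous.norm.rpow_const fun _ => Or.inr hq'.le)
    continuous_zero).1 h2
  ext x
  simpa [Real.rpow_eq_zero (abs_nonneg _) hq'.ne'] using congrFun h3 x

theorem stmt7 (d : ℕ) (hd : 2 ≤ d) (α β : ℝ)
    (hα : 0 ≤ α) (h1 : 0 ≤ 2*α + (d:ℝ)*β) (h2 : 0 ≤ 2*α + ((d:ℝ)-2)*β)
    (hne : (α, β) ≠ (0, 0)) (hda : ¬ (d = 2 ∧ α = 0))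
    (f : ℝ → ℝ) (hf : Differentiable ℝ f)
    (C q₁ q₂ : ℝ) (hC : 0 < C) (hq1 : 2 + 4/(d:ℝ) < q₁) (hq12 : q₁ ≤ q₂)
    (hq2 : 3 ≤ d → q₂ ≤ 2 + 4/((d:ℝ)-2))
    (hbound : ∀ u : ℝ, |f u| + |u * deriv f u| ≤ C * (|u| ^ q₁ + |u| ^ q₂)) :
    ∀ A > 0, ∃ δ > 0, ∀ φ : SchwartzMap (EuclideanSpace ℝ (Fin d)) ℝ, φ ≠ 0 →
      (∫ x, (φ x)^2) + (∫ x, ‖fderiv ℝ (⇑φ) x‖^2) ≤ A →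
      ((2*α + ((d:ℝ)-2)*β)/2) * (∫ x, ‖fderiv ℝ (⇑φ) x‖^2)
          + ((2*α + (d:ℝ)*β)/2) * (∫ x, (φ x)^2) ≤ δ →
      0 < ((2*α + ((d:ℝ)-2)*β)/2) * (∫ x, ‖fderiv ℝ (⇑φ) x‖^2)
            + ((2*α + (d:ℝ)*β)/2) * (∫ x, (φ x)^2)
            - (∫ x, (α * φ x * deriv f (φ x) + (d:ℝ)*β * f (φ x))) := by
  intro A hA
  have hd2 : (2 : ℝ) ≤ d := by exact_mod_cast hd
  set a : ℝ := (2*α + ((d:ℝ)-2)*β)/2 with ha_def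
  set b : ℝ := (2*α + (d:ℝ)*β)/2 with hb_def
  have hb : 0 ≤ b := by positivity
  have ha : 0 < a := by
    refine lt_of_le_of_ne (by positivity) fun ha => ?_
    have hβ : 0 ≤ β := by linarith
    have hαβ : 0 ≤ (d - 2) * β := mul_nonneg (by linarith) hβ
    have hα0 : α = 0 := by linarith
    have hdβ : (d - 2) * β = 0 := by linarith
    rcases mul_eq_zero.1 hdβ with h | h
    · exact hda ⟨by exact_mod_cast (by linarith : (d : ℝ) = 2), hα0⟩
    · exact hne (by rw [hα0, h])
  obtain ⟨K₁, θ₁, hθ₁, hK₁⟩ := SchwartzMap.exists_integral_rpow_le_superlinear hd hq1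
    (fun h => hq12.trans (hq2 h)) A
  obtain ⟨K₂, θ₂, hθ₂, hK₂⟩ := SchwartzMap.exists_integral_rpow_le_superlinear hd
    (hq1.trans_le hq12) hq2 A
  set c : ℝ := (α + d * |β|) * C with hc_def
  have hc : 0 ≤ c := by positivity
  have hsmall : ∀ᶠ g in 𝓝 (0 : ℝ), c * (K₁ * g ^ θ₁ + K₂ * g ^ θ₂) < a := by
    have hcont : ContinuousAt (fun g : ℝ => c * (K₁ * g ^ θ₁ + K₂ * g ^ θ₂)) 0 :=
      (((Real.continuousAt_rpow_const _ _ (Or.inr hθ₁.le)).const_mul _).add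
        ((Real.continuousAt_rpow_const _ _ (Or.inr hθ₂.le)).const_mul _)).const_mul _
    refine hcont.tendsto.eventually_lt_const ?_
    simpa [Real.zero_rpow hθ₁.ne', Real.zero_rpow hθ₂.ne'] using ha
  obtain ⟨ε, hε, hsmall⟩ := Metric.eventually_nhds_iff.1 hsmall
  refine ⟨a * (ε / 2), by positivity, fun φ hφ hφA hφδ => ?_⟩
  have hG := SchwartzMap.integral_norm_fderiv_sq_pos hd hφ
  set G := ∫ x, ‖fderiv ℝ φ x‖ ^ 2
  have hM : 0 ≤ ∫ x, φ x ^ 2 := integral_nonneg fun x => by positivity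
  set M := ∫ x, φ x ^ 2
  have hbM : 0 ≤ b * M := mul_nonneg hb hM
  have hGε : G < ε := by
    have : G ≤ ε / 2 := le_of_mul_le_mul_left (by linarith) ha
    linarith
  have hq₁ : 0 < q₁ := lt_trans (by positivity) hq1
  have hI₁ : Integrable fun x => |φ x| ^ q₁ := φ.integrable_norm_rpow volume hq₁
  have hI₂ : Integrable fun x => |φ x| ^ q₂ :=
    φ.integrable_norm_rpow volume (hq₁.trans_le hq12)
  have hN : ∫ x, (α * φ x * deriv f (φ x) + (d:ℝ)*β * f (φ x)) ≤
      c * ((∫ x, |φ x| ^ q₁) + ∫ x, |φ x| ^ q₂) := by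
    rw [← integral_add hI₁ hI₂, ← integral_const_mul]
    refine (le_abs_self _).trans (norm_integral_le_of_norm_le
      (f := fun x => α * φ x * deriv f (φ x) + (d : ℝ) * β * f (φ x))
      (g := fun x => c * (|φ x| ^ q₁ + |φ x| ^ q₂)) ((hI₁.add hI₂).const_mul c)
      (ae_of_all _ fun x => ?_))
    calc |α * φ x * deriv f (φ x) + d * β * f (φ x)|
        ≤ |α * φ x * deriv f (φ x)| + |d * β * f (φ x)| := abs_add_le _ _
      _ = α * |φ x * deriv f (φ x)| + d * |β| * |f (φ x)| := by
          rw [mul_assoc α, abs_mul α, abs_of_nonneg hα, abs_mul (d * β), abs_mul (d : ℝ) β,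
            Nat.abs_cast]
      _ ≤ (α + d * |β|) * (|f (φ x)| + |φ x * deriv f (φ x)|) := by
          have e1 : 0 ≤ α * |f (φ x)| := by positivity
          have e2 : 0 ≤ d * |β| * |φ x * deriv f (φ x)| := by positivity
          linarith
      _ ≤ (α + d * |β|) * (C * (|φ x| ^ q₁ + |φ x| ^ q₂)) := by
          gcongr
          exact hbound _
      _ = c * (|φ x| ^ q₁ + |φ x| ^ q₂) := by rw [hc_def]; ring
  have hMA : M ≤ A := by linarith
  have hNG : c * ((∫ x, |φ x| ^ q₁) + ∫ x, |φ x| ^ q₂) ≤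
      c * (K₁ * G ^ θ₁ + K₂ * G ^ θ₂) * G := by
    calc _ ≤ c * (K₁ * G ^ (1 + θ₁) + K₂ * G ^ (1 + θ₂)) := by
          gcongr
          exacts [hK₁ φ hMA, hK₂ φ hMA]
      _ = _ := by rw [Real.rpow_add hG, Real.rpow_add hG, Real.rpow_one]; ring
  have hlt : c * (K₁ * G ^ θ₁ + K₂ * G ^ θ₂) * G < a * G :=
    mul_lt_mul_of_pos_right (hsmall (by simpa [abs_of_pos hG] using hGε)) hG
  linarith
end

section
/- Let d ≥ 2 be an integer, ε > 0, let (α,β) ∈ ℝ² be admissible with μ̄ := max(2α+dβ, 2α+(d−2)β), and let f : ℝ → ℝ be twice differentiable satisfying the convexity conditions with parameter ε and strong subcritical growth. Then the infimum of J(φ) over all real-valued Schwartz functions φ ≢ 0 on ℝ^d with K_{α,β}(φ) = 0 equals the infimum of H_{α,β}(φ) over all real-valued Schwartz functions φ ≢ 0 with K_{α,β}(φ) ≤ 0 (both taken in ℝ ∪ {+∞}, with infimum over the empty set equal to +∞). -/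
noncomputable def gradN2 {d : ℕ} (u : EuclideanSpace ℝ (Fin d) → ℝ) : ℝ :=
  ∫ x, ‖fderiv ℝ u x‖^2

noncomputable def massN2 {d : ℕ} (u : EuclideanSpace ℝ (Fin d) → ℝ) : ℝ :=
  ∫ x, (u x)^2

noncomputable def Ffun {d : ℕ} (f : ℝ → ℝ) (u : EuclideanSpace ℝ (Fin d) → ℝ) : ℝ :=
  ∫ x, f (u x)

noncomputable def Jfun {d : ℕ} (f : ℝ → ℝ) (u : EuclideanSpace ℝ (Fin d) → ℝ) : ℝ :=
  (gradN2 u + massN2 u) / 2 - Ffun f u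

noncomputable def Kfun {d : ℕ} (f : ℝ → ℝ) (α β : ℝ)
    (u : EuclideanSpace ℝ (Fin d) → ℝ) : ℝ :=
  ((2*α + ((d:ℝ)-2)*β)/2) * gradN2 u + ((2*α + (d:ℝ)*β)/2) * massN2 u
    - ∫ x, (α * u x * deriv f (u x) + (d:ℝ) * β * f (u x))

noncomputable def Hfun {d : ℕ} (f : ℝ → ℝ) (α β : ℝ)
    (u : EuclideanSpace ℝ (Fin d) → ℝ) : ℝ :=
  Jfun f u - Kfun f α β u / max (2*α + (d:ℝ)*β) (2*α + ((d:ℝ)-2)*β)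

open MeasureTheory Real Filter Topology
open scoped SchwartzMap

/-- The two-parameter dilation `φ ↦ e^{at} φ(e^{-bt} ·)`. -/
noncomputable def dilate {d : ℕ} (a b t : ℝ) (φ : 𝓢(EuclideanSpace ℝ (Fin d), ℝ)) :
    𝓢(EuclideanSpace ℝ (Fin d), ℝ) :=
  exp (a * t) • SchwartzMap.compCLMOfContinuousLinearEquiv ℝ
    (ContinuousLinearEquiv.smulLeft (R₁ := ℝ) (M₁ := EuclideanSpace ℝ (Fin d))
      (Units.mk0 (exp (-b * t)) (exp_pos _).ne')) φ

section Dilation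

variable {d : ℕ}

theorem dilate_apply (a b t : ℝ) (φ : 𝓢(EuclideanSpace ℝ (Fin d), ℝ))
    (x : EuclideanSpace ℝ (Fin d)) :
    dilate a b t φ x = exp (a * t) * φ (exp (-b * t) • x) := by
  rfl

theorem integral_comp_dilation (b t : ℝ) (g : EuclideanSpace ℝ (Fin d) → ℝ) :
    ∫ x, g (exp (-b * t) • x) = exp (d * b * t) * ∫ x, g x := by
  rw [Measure.integral_comp_smul volume g, finrank_euclideanSpace_fin, smul_eq_mul,
    abs_of_pos (by positivity), ← exp_nat_mul, ← exp_neg]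
  congr 2
  ring

theorem dilate_ne_zero (a b t : ℝ) {φ : 𝓢(EuclideanSpace ℝ (Fin d), ℝ)} (hφ : φ ≠ 0) :
    dilate a b t φ ≠ 0 := by
  contrapose! hφ
  ext x
  have h := dilate_apply a b t φ ((exp (-b * t))⁻¹ • x)
  rw [hφ, smul_inv_smul₀ (exp_pos _).ne'] at h
  simpa [(exp_pos _).ne'] using h.symm

theorem integral_comp_dilate (a b t : ℝ) (φ : 𝓢(EuclideanSpace ℝ (Fin d), ℝ)) (k : ℝ → ℝ) :
    ∫ x, k (dilate a b t φ x) = exp (d * b * t) * ∫ x, k (exp (a * t) * φ x) := by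
  simp only [dilate_apply]
  exact integral_comp_dilation b t fun x ↦ k (exp (a * t) * φ x)

theorem massN2_dilate (a b t : ℝ) (φ : 𝓢(EuclideanSpace ℝ (Fin d), ℝ)) :
    massN2 (dilate a b t φ) = exp ((2 * a + d * b) * t) * massN2 φ := by
  unfold massN2
  rw [integral_comp_dilate a b t φ (· ^ 2)]
  simp only [mul_pow]
  rw [integral_const_mul, ← mul_assoc, ← exp_nat_mul, ← exp_add]
  congr 2
  push_cast
  ring

theorem gradN2_dilate (a b t : ℝ) (φ : 𝓢(EuclideanSpace ℝ (Fin d), ℝ)) :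
    gradN2 (dilate a b t φ) = exp ((2 * a + ((d : ℝ) - 2) * b) * t) * gradN2 φ := by
  unfold gradN2
  have h (x : EuclideanSpace ℝ (Fin d)) : ‖fderiv ℝ (dilate a b t φ) x‖ ^ 2 =
      exp (2 * (a - b) * t) * ‖fderiv ℝ φ (exp (-b * t) • x)‖ ^ 2 := by
    have h₁ : ⇑(dilate a b t φ) = exp (a * t) • fun x ↦ φ (exp (-b * t) • x) := by
      ext x
      simp [dilate_apply]
    have h₂ : DifferentiableAt ℝ (fun x ↦ φ (exp (-b * t) • x)) x :=
      φ.differentiableAt.comp x (by fun_prop)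
    rw [h₁, fderiv_const_smul h₂, fderiv_comp_smul, norm_smul, norm_smul, mul_pow, mul_pow,
      norm_of_nonneg (exp_pos _).le, norm_of_nonneg (exp_pos _).le, ← mul_assoc, ← exp_nat_mul,
      ← exp_nat_mul, ← exp_add]
    congr 2
    push_cast
    ring
  simp only [h]
  rw [integral_const_mul, integral_comp_dilation b t fun x ↦ ‖fderiv ℝ φ x‖ ^ 2, ← mul_assoc,
    ← exp_add]
  congr 2
  ring

end Dilation

section Positivity

variable {d : ℕ}

theorem massN2_nonneg (φ : EuclideanSpace ℝ (Fin d) → ℝ) : 0 ≤ massN2 φ :=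
  integral_nonneg fun _ ↦ sq_nonneg _

theorem gradN2_nonneg (φ : EuclideanSpace ℝ (Fin d) → ℝ) : 0 ≤ gradN2 φ :=
  integral_nonneg fun _ ↦ sq_nonneg _

theorem massN2_pos {φ : 𝓢(EuclideanSpace ℝ (Fin d), ℝ)} (hφ : φ ≠ 0) : 0 < massN2 φ := by
  obtain ⟨x, hx⟩ := DFunLike.ne_iff.1 hφ
  exact integral_pos_of_integrable_nonneg_nonzero (φ.continuous.pow 2) (φ.memLp 2).integrable_sq
    (fun _ ↦ sq_nonneg _) (pow_ne_zero 2 hx)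

theorem gradN2_pos (hd : 0 < d) {φ : 𝓢(EuclideanSpace ℝ (Fin d), ℝ)} (hφ : φ ≠ 0) :
    0 < gradN2 φ := by
  have : Nonempty (Fin d) := ⟨⟨0, hd⟩⟩
  let ψ := SchwartzMap.fderivCLM ℝ (EuclideanSpace ℝ (Fin d)) ℝ φ
  obtain ⟨x, hx⟩ : ∃ x, fderiv ℝ φ x ≠ 0 := by
    by_contra! h
    apply hφ
    ext y
    have hconst : ⇑φ = fun _ ↦ φ y := funext fun z ↦
      is_const_of_fderiv_eq_zero φ.differentiable h z y
    have hlim := φ.tendsto_cocompact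
    rw [hconst] at hlim
    exact tendsto_nhds_unique tendsto_const_nhds hlim
  exact integral_pos_of_integrable_nonneg_nonzero (f := fun x ↦ ‖ψ x‖ ^ 2)
    (ψ.continuous.norm.pow 2) ((ψ.memLp 2 volume).integrable_norm_pow two_ne_zero) (fun _ ↦ sq_nonneg _)
    (pow_ne_zero 2 (norm_ne_zero_iff.2 hx))

end Positivity

section Growth

variable {d : ℕ} {k : ℝ → ℝ} {C q₁ q₂ : ℝ}

theorem integrable_abs_rpow (φ : 𝓢(EuclideanSpace ℝ (Fin d), ℝ)) {q : ℝ} (hq : 0 < q) :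
    Integrable fun x ↦ |φ x| ^ q := by
  simpa [ENNReal.toReal_ofReal hq.le] using
    (φ.memLp (ENNReal.ofReal q)).integrable_norm_rpow (by simpa using hq) (by simp)

theorem integrable_comp_of_growth (φ : 𝓢(EuclideanSpace ℝ (Fin d), ℝ)) (hk : Continuous k)
    (hq₁ : 0 < q₁) (hq₂ : 0 < q₂) (hgrowth : ∀ u, |k u| ≤ C * (|u| ^ q₁ + |u| ^ q₂)) :
    Integrable fun x ↦ k (φ x) :=
  (((integrable_abs_rpow φ hq₁).add (integrable_abs_rpow φ hq₂)).const_mul C).mono'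
    (hk.comp φ.continuous).aestronglyMeasurable (ae_of_all _ fun x ↦ hgrowth (φ x))

theorem growth_comp_mul_le (hC : 0 ≤ C) (hq₁ : 0 < q₁) (hq : q₁ ≤ q₂)
    (hgrowth : ∀ u, |k u| ≤ C * (|u| ^ q₁ + |u| ^ q₂)) {s : ℝ} (hs : s ∈ Set.Icc (0 : ℝ) 1)
    (u : ℝ) : |k (s * u)| ≤ s ^ q₁ * (C * (|u| ^ q₁ + |u| ^ q₂)) := by
  have hle : s ^ q₂ ≤ s ^ q₁ := by
    rcases hs.1.eq_or_lt with rfl | h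
    · rw [zero_rpow hq₁.ne', zero_rpow (hq₁.trans_le hq).ne']
    · exact rpow_le_rpow_of_exponent_ge h hs.2 hq
  calc |k (s * u)| ≤ C * (s ^ q₁ * |u| ^ q₁ + s ^ q₂ * |u| ^ q₂) := by
        simpa only [abs_mul, abs_of_nonneg hs.1, mul_rpow hs.1 (abs_nonneg u)] using
          hgrowth (s * u)
    _ ≤ C * (s ^ q₁ * |u| ^ q₁ + s ^ q₁ * |u| ^ q₂) := by gcongr
    _ = s ^ q₁ * (C * (|u| ^ q₁ + |u| ^ q₂)) := by ring

theorem continuousOn_integral_comp_mul (φ : 𝓢(EuclideanSpace ℝ (Fin d), ℝ)) (hk : Continuous k)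
    (hC : 0 ≤ C) (hq₁ : 0 < q₁) (hq : q₁ ≤ q₂)
    (hgrowth : ∀ u, |k u| ≤ C * (|u| ^ q₁ + |u| ^ q₂)) :
    ContinuousOn (fun s : ℝ ↦ ∫ x, k (s * φ x)) (Set.Icc 0 1) := by
  refine continuousOn_of_dominated (bound := fun x ↦ C * (|φ x| ^ q₁ + |φ x| ^ q₂))
    (fun s _ ↦ (hk.comp (φ.continuous.const_mul s)).aestronglyMeasurable)
    (fun s hs ↦ ae_of_all _ fun x ↦ ?_)
    (((integrable_abs_rpow φ hq₁).add (integrable_abs_rpow φ (hq₁.trans_le hq))).const_mul C)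
    (ae_of_all _ fun x ↦ (hk.comp (continuous_id.mul_const (φ x))).continuousOn)
  exact (growth_comp_mul_le hC hq₁ hq hgrowth hs (φ x)).trans
    (mul_le_of_le_one_left (by positivity) (rpow_le_one hs.1 hs.2 hq₁.le))

theorem abs_integral_comp_mul_le (φ : 𝓢(EuclideanSpace ℝ (Fin d), ℝ)) (hC : 0 ≤ C)
    (hq₁ : 0 < q₁) (hq : q₁ ≤ q₂) (hgrowth : ∀ u, |k u| ≤ C * (|u| ^ q₁ + |u| ^ q₂)) {s : ℝ}
    (hs : s ∈ Set.Icc (0 : ℝ) 1) :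
    |∫ x, k (s * φ x)| ≤ s ^ q₁ * ∫ x, C * (|φ x| ^ q₁ + |φ x| ^ q₂) := by
  rw [← integral_const_mul]
  exact norm_integral_le_of_norm_le (f := fun x ↦ k (s * φ x))
    (g := fun x ↦ s ^ q₁ * (C * (|φ x| ^ q₁ + |φ x| ^ q₂)))
    ((((integrable_abs_rpow φ hq₁).add
      (integrable_abs_rpow φ (hq₁.trans_le hq))).const_mul C).const_mul _)
    (ae_of_all _ fun x ↦ growth_comp_mul_le hC hq₁ hq hgrowth hs (φ x))

end Growth

theorem exists_nonpos_mul_exp_lt {c D r r' : ℝ} (hc : 0 < c) (hr : r < r') :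
    ∃ t ≤ (0 : ℝ), D * exp (r' * t) < c * exp (r * t) := by
  have h : Tendsto (fun t : ℝ ↦ D * exp ((r' - r) * t)) atBot (𝓝 (D * 0)) :=
    (tendsto_exp_atBot.comp (tendsto_id.const_mul_atBot (sub_pos.2 hr))).const_mul D
  rw [mul_zero] at h
  obtain ⟨t, ht, ht₀⟩ := ((h.eventually_lt_const hc).and (eventually_le_atBot 0)).exists
  refine ⟨t, ht₀, ?_⟩
  calc D * exp (r' * t) = D * exp ((r' - r) * t) * exp (r * t) := by
        rw [mul_assoc, ← exp_add]
        congr 2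
        ring
    _ < c * exp (r * t) := by gcongr

section Functionals

variable {d : ℕ} {f : ℝ → ℝ} {α β : ℝ}

theorem Kfun_dilate (a b t : ℝ) (φ : 𝓢(EuclideanSpace ℝ (Fin d), ℝ)) :
    Kfun f α β (dilate a b t φ) =
      ((2 * α + ((d : ℝ) - 2) * β) / 2) * (exp ((2 * a + ((d : ℝ) - 2) * b) * t) * gradN2 φ)
      + ((2 * α + (d : ℝ) * β) / 2) * (exp ((2 * a + d * b) * t) * massN2 φ)
      - exp (d * b * t) * ∫ x, (α * (exp (a * t) * φ x) * deriv f (exp (a * t) * φ x)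
          + d * β * f (exp (a * t) * φ x)) := by
  rw [Kfun, gradN2_dilate, massN2_dilate,
    integral_comp_dilate a b t φ fun u ↦ α * u * deriv f u + d * β * f u]

theorem exists_Kfun_dilate_eq_zero {a b C q₁ q₂ : ℝ} (hd : 0 < d) (ha : 0 < a)
    (h1 : 0 ≤ 2 * α + (d : ℝ) * β) (h2 : 0 ≤ 2 * α + ((d : ℝ) - 2) * β)
    (hk : Continuous fun u ↦ α * u * deriv f u + d * β * f u)
    (hC : 0 ≤ C) (hq₁ : 0 < q₁) (hq : q₁ ≤ q₂)
    (hgrowth : ∀ u, |α * u * deriv f u + d * β * f u| ≤ C * (|u| ^ q₁ + |u| ^ q₂))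
    (hdom : 0 < 2 * α + (d : ℝ) * β ∧ 2 * a + d * b < d * b + a * q₁ ∨
      0 < 2 * α + ((d : ℝ) - 2) * β ∧ 2 * a + ((d : ℝ) - 2) * b < d * b + a * q₁)
    {φ : 𝓢(EuclideanSpace ℝ (Fin d), ℝ)} (hφ : φ ≠ 0) (hK : Kfun f α β φ ≤ 0) :
    ∃ t ≤ (0 : ℝ), Kfun f α β (dilate a b t φ) = 0 := by
  have hmem {t : ℝ} (ht : t ≤ 0) : exp (a * t) ∈ Set.Icc (0 : ℝ) 1 :=
    ⟨(exp_pos _).le, exp_le_one_iff.2 (mul_nonpos_of_nonneg_of_nonpos ha.le ht)⟩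
  set D := ∫ x, C * (|φ x| ^ q₁ + |φ x| ^ q₂)
  have hN {t : ℝ} (ht : t ≤ 0) :
      exp (d * b * t) * ∫ x, (α * (exp (a * t) * φ x) * deriv f (exp (a * t) * φ x)
          + d * β * f (exp (a * t) * φ x)) ≤ D * exp ((d * b + a * q₁) * t) := by
    calc _ ≤ exp (d * b * t) * (exp (a * t) ^ q₁ * D) := by
          gcongr
          exact (le_abs_self _).trans (abs_integral_comp_mul_le φ hC hq₁ hq hgrowth (hmem ht))
      _ = D * exp ((d * b + a * q₁) * t) := by
          rw [← exp_mul, ← mul_assoc, ← exp_add, mul_comm]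
          congr 2
          ring
  have hA := gradN2_nonneg (⇑φ)
  have hM := massN2_nonneg (⇑φ)
  obtain ⟨t₁, ht₁, hpos⟩ : ∃ t ≤ (0 : ℝ), 0 < Kfun f α β (dilate a b t φ) := by
    rcases hdom with ⟨hc, hr⟩ | ⟨hc, hr⟩
    · obtain ⟨t, ht, hlt⟩ := exists_nonpos_mul_exp_lt (D := D)
        (mul_pos (half_pos hc) (massN2_pos hφ)) hr
      refine ⟨t, ht, ?_⟩
      rw [Kfun_dilate]
      have : 0 ≤ ((2 * α + ((d : ℝ) - 2) * β) / 2) *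
        (exp ((2 * a + ((d : ℝ) - 2) * b) * t) * gradN2 φ) := by positivity
      linarith [hN ht]
    · obtain ⟨t, ht, hlt⟩ := exists_nonpos_mul_exp_lt (D := D)
        (mul_pos (half_pos hc) (gradN2_pos hd hφ)) hr
      refine ⟨t, ht, ?_⟩
      rw [Kfun_dilate]
      have : 0 ≤ ((2 * α + (d : ℝ) * β) / 2) *
        (exp ((2 * a + d * b) * t) * massN2 φ) := by positivity
      linarith [hN ht]
  have hcont : ContinuousOn (fun t ↦ Kfun f α β (dilate a b t φ)) (Set.Icc t₁ 0) := by
    simp only [Kfun_dilate]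
    refine ContinuousOn.sub (by fun_prop) (ContinuousOn.mul (by fun_prop) ?_)
    exact (continuousOn_integral_comp_mul φ hk hC hq₁ hq hgrowth).comp
      (f := fun t ↦ exp (a * t)) (by fun_prop) fun t ht ↦ hmem ht.2
  have hzero : Kfun f α β (dilate a b 0 φ) = Kfun f α β φ := by
    rw [Kfun_dilate]
    simp [Kfun]
  obtain ⟨t, ht, h⟩ := intermediate_value_Icc' ht₁ hcont ⟨hzero.trans_le hK, hpos.le⟩
  exact ⟨t, ht.2, h⟩

theorem max_mul_Hfun {C q₁ q₂ : ℝ}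
    (hμ : 0 < max (2 * α + (d : ℝ) * β) (2 * α + ((d : ℝ) - 2) * β))
    (hf : Continuous f) (hf' : Continuous (deriv f)) (hq₁ : 0 < q₁) (hq₂ : 0 < q₂)
    (hgf : ∀ u, |f u| ≤ C * (|u| ^ q₁ + |u| ^ q₂))
    (hgf' : ∀ u, |u * deriv f u| ≤ C * (|u| ^ q₁ + |u| ^ q₂))
    (φ : 𝓢(EuclideanSpace ℝ (Fin d), ℝ)) :
    max (2 * α + (d : ℝ) * β) (2 * α + ((d : ℝ) - 2) * β) * Hfun f α β φ =
      (max (2 * α + (d : ℝ) * β) (2 * α + ((d : ℝ) - 2) * β) - (2 * α + ((d : ℝ) - 2) * β)) / 2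
        * gradN2 φ
      + (max (2 * α + (d : ℝ) * β) (2 * α + ((d : ℝ) - 2) * β) - (2 * α + (d : ℝ) * β)) / 2
        * massN2 φ
      + ∫ x, (α * (φ x * deriv f (φ x))
        + (d * β - max (2 * α + (d : ℝ) * β) (2 * α + ((d : ℝ) - 2) * β)) * f (φ x)) := by
  have i₁ := integrable_comp_of_growth φ hf hq₁ hq₂ hgf
  have i₂ : Integrable fun x ↦ φ x * deriv f (φ x) :=
    integrable_comp_of_growth φ (continuous_id.mul hf') hq₁ hq₂ hgf'
  have hK : ∫ x, (α * φ x * deriv f (φ x) + (d : ℝ) * β * f (φ x)) =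
      α * (∫ x, φ x * deriv f (φ x)) + d * β * ∫ x, f (φ x) := by
    simp only [mul_assoc α]
    rw [integral_add (i₂.const_mul α) (i₁.const_mul _), integral_const_mul, integral_const_mul]
  rw [integral_add (i₂.const_mul α) (i₁.const_mul _), integral_const_mul, integral_const_mul,
    Hfun, Jfun, Kfun, Ffun, hK]
  generalize max (2 * α + (d : ℝ) * β) (2 * α + ((d : ℝ) - 2) * β) = μ at hμ ⊢
  field_simp
  ring

theorem Hfun_dilate_le {a b C q₁ q₂ t : ℝ}
    (ht : t ≤ 0) (hab1 : 0 ≤ 2 * a + (d : ℝ) * b) (hab2 : 0 ≤ 2 * a + ((d : ℝ) - 2) * b)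
    (hμ : 0 < max (2 * α + (d : ℝ) * β) (2 * α + ((d : ℝ) - 2) * β))
    (hf : Continuous f) (hf' : Continuous (deriv f)) (hq₁ : 0 < q₁) (hq₂ : 0 < q₂)
    (hgf : ∀ u, |f u| ≤ C * (|u| ^ q₁ + |u| ^ q₂))
    (hgf' : ∀ u, |u * deriv f u| ≤ C * (|u| ^ q₁ + |u| ^ q₂))
    (hmono : ∀ u, exp (d * b * t) *
      (α * (exp (a * t) * u * deriv f (exp (a * t) * u))
        + (d * β - max (2 * α + (d : ℝ) * β) (2 * α + ((d : ℝ) - 2) * β)) * f (exp (a * t) * u))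
      ≤ α * (u * deriv f u)
        + (d * β - max (2 * α + (d : ℝ) * β) (2 * α + ((d : ℝ) - 2) * β)) * f u)
    (φ : 𝓢(EuclideanSpace ℝ (Fin d), ℝ)) :
    Hfun f α β (dilate a b t φ) ≤ Hfun f α β φ := by
  refine le_of_mul_le_mul_left ?_ hμ
  rw [max_mul_Hfun hμ hf hf' hq₁ hq₂ hgf hgf', max_mul_Hfun hμ hf hf' hq₁ hq₂ hgf hgf']
  set μ := max (2 * α + (d : ℝ) * β) (2 * α + ((d : ℝ) - 2) * β)
  have hint (ψ : 𝓢(EuclideanSpace ℝ (Fin d), ℝ)) :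
      Integrable fun x ↦ α * (ψ x * deriv f (ψ x)) + (d * β - μ) * f (ψ x) :=
    ((integrable_comp_of_growth ψ (continuous_id.mul hf') hq₁ hq₂ hgf').const_mul α).add
      ((integrable_comp_of_growth ψ hf hq₁ hq₂ hgf).const_mul _)
  have hψ : ⇑(dilate a 0 t φ) = fun x ↦ exp (a * t) * φ x := by
    ext x
    simp [dilate_apply]
  have hint' := hint (dilate a 0 t φ)
  rw [hψ] at hint'
  rw [gradN2_dilate, massN2_dilate,
    integral_comp_dilate a b t φ fun u ↦ α * (u * deriv f u) + (d * β - μ) * f u,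
    ← integral_const_mul]
  have hμ₁ : 0 ≤ μ - (2 * α + (d : ℝ) * β) := sub_nonneg.2 (le_max_left _ _)
  have hμ₂ : 0 ≤ μ - (2 * α + ((d : ℝ) - 2) * β) := sub_nonneg.2 (le_max_right _ _)
  gcongr ?_ * ?_ + ?_ * ?_ + ?_
  · exact mul_le_of_le_one_left (gradN2_nonneg _)
      (exp_le_one_iff.2 (mul_nonpos_of_nonneg_of_nonpos hab2 ht))
  · exact mul_le_of_le_one_left (massN2_nonneg _)
      (exp_le_one_iff.2 (mul_nonpos_of_nonneg_of_nonpos hab1 ht))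
  · exact integral_mono (hint'.const_mul _) (hint φ) fun x ↦ hmono (φ x)

end Functionals

/-- Pointwise form of `(L - μ̄) L F ≥ 0`, written for `X = f(v)`, `Y = v f'(v)`, `Z = v² f''(v)`. -/
theorem second_variation_nonneg {d ε α β X Y Z : ℝ} (hd : 0 < d) (hε : 0 < ε) (hα : 0 ≤ α)
    (h1 : 0 ≤ 2 * α + d * β) (h2 : 0 ≤ 2 * α + (d - 2) * β) (hX : 0 ≤ X)
    (hY : (2 + 4 / d + ε) * X ≤ Y)
    (hZ : 0 ≤ Z - (1 + (2 + 4 / d + ε)) * Y + 2 * (2 + 4 / d + ε) * X) :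
    0 ≤ d * β * (α * Y + (d * β - max (2 * α + d * β) (2 * α + (d - 2) * β)) * X)
      + α * (α * (Y + Z) + (d * β - max (2 * α + d * β) (2 * α + (d - 2) * β)) * Y) := by
  have hδ : 0 ≤ α * (4 / d + ε) + 2 * β := by
    have h : α * (4 / d) + 2 * β = 2 / d * (2 * α + d * β) := by
      field_simp
      ring
    have : 0 ≤ 2 / d * (2 * α + d * β) := by positivity
    nlinarith [mul_nonneg hα hε.le]
  set δ := 4 / d + ε with hδ_def
  have hδ₀ : 0 < δ := by positivity
  have hp : 2 + 4 / d + ε = 2 + δ := by rw [hδ_def]; ring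
  rw [hp] at hY hZ
  have hYX : 0 ≤ Y - 2 * X := by nlinarith
  have hW : 0 ≤ α ^ 2 * (Z - (1 + (2 + δ)) * Y + 2 * (2 + δ) * X) := by positivity
  have hV : 0 ≤ α * (α * δ + 2 * β) * (Y - 2 * X) := by positivity
  rcases le_total 0 β with hβ | hβ
  · rw [max_eq_left (by linarith)]
    have : 0 ≤ (2 * α + (d - 2) * β) * (α * (Y - 2 * X)) := by positivity
    linarith
  · rw [max_eq_right (by linarith)]
    have h : 0 ≤ α * (Y - 2 * X) + 2 * β * X := by
      nlinarith [mul_nonneg hδ hX, mul_le_mul_of_nonneg_left hY hα]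
    have : 0 ≤ (2 * α + d * β) * (α * (Y - 2 * X) + 2 * β * X) := by positivity
    linarith

theorem exp_mul_variation_le {f : ℝ → ℝ} {D α c : ℝ}
    (hf1 : Differentiable ℝ f) (hf2 : Differentiable ℝ (deriv f))
    (h : ∀ v, 0 ≤ D * (α * (v * deriv f v) + c * f v)
      + α * (α * (v * deriv f v + v ^ 2 * deriv (deriv f) v) + c * (v * deriv f v)))
    {t : ℝ} (ht : t ≤ 0) (u : ℝ) :
    exp (D * t) * (α * (exp (α * t) * u * deriv f (exp (α * t) * u)) + c * f (exp (α * t) * u))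
      ≤ α * (u * deriv f u) + c * f u := by
  have hderiv (t : ℝ) : HasDerivAt (fun t ↦ exp (D * t) *
      (α * (exp (α * t) * u * deriv f (exp (α * t) * u)) + c * f (exp (α * t) * u)))
      (exp (D * t) * (D * (α * (exp (α * t) * u * deriv f (exp (α * t) * u))
        + c * f (exp (α * t) * u))
        + α * (α * (exp (α * t) * u * deriv f (exp (α * t) * u)
          + (exp (α * t) * u) ^ 2 * deriv (deriv f) (exp (α * t) * u))
          + c * (exp (α * t) * u * deriv f (exp (α * t) * u))))) t := by
    have he (r : ℝ) : HasDerivAt (fun t ↦ exp (r * t)) (exp (r * t) * (r * 1)) t :=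
      ((hasDerivAt_id t).const_mul r).exp
    have hv := (he α).mul_const u
    have hf := (hf1 (exp (α * t) * u)).hasDerivAt.comp t hv
    have hf' := (hf2 (exp (α * t) * u)).hasDerivAt.comp t hv
    refine ((he D).mul (((hv.mul hf').const_mul α).add (hf.const_mul c))).congr_deriv ?_
    simp only [Function.comp, Pi.add_apply, Pi.mul_apply]
    ring
  have hmono := monotone_of_hasDerivAt_nonneg hderiv
    fun t ↦ mul_nonneg (exp_pos _).le (h _)
  simpa using hmono ht

theorem stmt8 (d : ℕ) (hd : 2 ≤ d) (ε α β : ℝ) (hε : 0 < ε)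
    (hα : 0 ≤ α) (h1 : 0 ≤ 2*α + (d:ℝ)*β) (h2 : 0 ≤ 2*α + ((d:ℝ)-2)*β)
    (hne : (α, β) ≠ (0, 0))
    (f : ℝ → ℝ) (hf1 : Differentiable ℝ f) (hf2 : Differentiable ℝ (deriv f))
    (hpos : ∀ u : ℝ, 0 ≤ f u)
    (hconv1 : ∀ u : ℝ, (2 + 4/(d:ℝ) + ε) * f u ≤ u * deriv f u)
    (hconv2 : ∀ u : ℝ, 0 ≤ u^2 * deriv (deriv f) u
        - (1 + (2 + 4/(d:ℝ) + ε)) * (u * deriv f u) + 2 * (2 + 4/(d:ℝ) + ε) * f u)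
    (hgrowth : ∃ C > 0, ∃ q₁ q₂ : ℝ, 2 + 4/(d:ℝ) < q₁ ∧ q₁ ≤ q₂ ∧
        (3 ≤ d → q₂ ≤ 2 + 4/((d:ℝ)-2)) ∧
        ∀ u : ℝ, |f u| + |u * deriv f u| + |u^2 * deriv (deriv f) u|
          ≤ C * (|u| ^ q₁ + |u| ^ q₂)) :
    sInf {x : EReal | ∃ φ : SchwartzMap (EuclideanSpace ℝ (Fin d)) ℝ,
        φ ≠ 0 ∧ Kfun f α β ⇑φ = 0 ∧ x = (Jfun f ⇑φ : ℝ)}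
      = sInf {x : EReal | ∃ φ : SchwartzMap (EuclideanSpace ℝ (Fin d)) ℝ,
        φ ≠ 0 ∧ Kfun f α β ⇑φ ≤ 0 ∧ x = (Hfun f α β ⇑φ : ℝ)} := by
  obtain ⟨C, hC, q₁, q₂, hq₁, hq, -, hgrowth⟩ := hgrowth
  have hd₀ : (0 : ℝ) < d := by positivity
  have h4 : 0 < 4 / (d : ℝ) := by positivity
  have hq₁₀ : 0 < q₁ := by linarith
  have hf := hf1.continuous
  have hf' := hf2.continuous
  have hgf (u : ℝ) : |f u| ≤ C * (|u| ^ q₁ + |u| ^ q₂) := by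
    linarith [hgrowth u, abs_nonneg (u * deriv f u), abs_nonneg (u ^ 2 * deriv (deriv f) u)]
  have hgf' (u : ℝ) : |u * deriv f u| ≤ C * (|u| ^ q₁ + |u| ^ q₂) := by
    linarith [hgrowth u, abs_nonneg (f u), abs_nonneg (u ^ 2 * deriv (deriv f) u)]
  have hgk (u : ℝ) : |α * u * deriv f u + d * β * f u| ≤
      ((|α| + |d * β|) * C) * (|u| ^ q₁ + |u| ^ q₂) := by
    calc |α * u * deriv f u + d * β * f u| ≤ |α| * |u * deriv f u| + |d * β| * |f u| := by
          rw [← abs_mul, ← abs_mul, ← mul_assoc]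
          exact abs_add_le _ _
      _ ≤ |α| * (C * (|u| ^ q₁ + |u| ^ q₂)) + |d * β| * (C * (|u| ^ q₁ + |u| ^ q₂)) := by
          gcongr
          exacts [hgf' u, hgf u]
      _ = _ := by ring
  have hk : Continuous fun u ↦ α * u * deriv f u + d * β * f u := by fun_prop
  have hβ₀ (hα₀ : α = 0) : 0 < β := by
    rcases lt_trichotomy β 0 with hβ | rfl | hβ
    · subst hα₀
      nlinarith
    · exact absurd (Prod.ext hα₀ rfl : (α, (0 : ℝ)) = (0, 0)) hne
    · exact hβ
  have hpos' : 0 < 2 * α + (d : ℝ) * β ∨ 0 < 2 * α + ((d : ℝ) - 2) * β := by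
    by_contra! h
    have hβ : β = 0 := by linarith
    have hα₀ : α = 0 := by
      rw [hβ] at h
      linarith
    exact hβ.not_gt (hβ₀ hα₀)
  have hμ : 0 < max (2 * α + (d : ℝ) * β) (2 * α + ((d : ℝ) - 2) * β) := lt_max_iff.2 hpos'
  obtain ⟨a, b, ha, hab1, hab2, hdom, hmono⟩ : ∃ a b : ℝ, 0 < a ∧ 0 ≤ 2 * a + (d : ℝ) * b ∧
      0 ≤ 2 * a + ((d : ℝ) - 2) * b ∧
      (0 < 2 * α + (d : ℝ) * β ∧ 2 * a + d * b < d * b + a * q₁ ∨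
        0 < 2 * α + ((d : ℝ) - 2) * β ∧ 2 * a + ((d : ℝ) - 2) * b < d * b + a * q₁) ∧
      ∀ t ≤ (0 : ℝ), ∀ u, exp (d * b * t) *
        (α * (exp (a * t) * u * deriv f (exp (a * t) * u))
          + (d * β - max (2 * α + (d : ℝ) * β) (2 * α + ((d : ℝ) - 2) * β))
            * f (exp (a * t) * u))
        ≤ α * (u * deriv f u)
          + (d * β - max (2 * α + (d : ℝ) * β) (2 * α + ((d : ℝ) - 2) * β)) * f u := by
    rcases hα.eq_or_lt with hα₀ | hα₀
    · have hβ := hβ₀ hα₀.symm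
      have hdβ : 0 < (d : ℝ) * β := by positivity
      subst hα₀
      refine ⟨1, 0, one_pos, by norm_num, by norm_num, .inl ⟨by linarith, by linarith⟩,
        fun t _ u ↦ le_of_eq ?_⟩
      rw [max_eq_left (by linarith)]
      ring
    · refine ⟨α, β, hα₀, h1, h2, hpos'.imp (fun h ↦ ⟨h, by nlinarith⟩) (fun h ↦ ⟨h, ?_⟩),
        fun t ht u ↦ exp_mul_variation_le hf1 hf2 (fun v ↦ ?_) ht u⟩
      · have hαq : α * (2 + 4 / d) < α * q₁ := mul_lt_mul_of_pos_left hq₁ hα₀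
        have h : α * (4 / d) + 2 * β = 2 / d * (2 * α + d * β) := by
          field_simp
          ring
        have : 0 ≤ 2 / d * (2 * α + d * β) := by positivity
        linarith
      · exact second_variation_nonneg hd₀ hε hα h1 h2 (hpos v) (hconv1 v) (hconv2 v)
  apply le_antisymm
  · refine le_sInf ?_
    rintro _ ⟨φ, hφ, hK, rfl⟩
    obtain ⟨t, ht, hKt⟩ := exists_Kfun_dilate_eq_zero (by omega) ha h1 h2 hk (by positivity)
      hq₁₀ hq hgk hdom hφ hK
    refine sInf_le_of_le ⟨dilate a b t φ, dilate_ne_zero a b t hφ, hKt, rfl⟩ ?_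
    rw [EReal.coe_le_coe_iff]
    calc Jfun f (dilate a b t φ) = Hfun f α β (dilate a b t φ) := by simp [Hfun, hKt]
      _ ≤ Hfun f α β φ := Hfun_dilate_le ht hab1 hab2 hμ hf hf' hq₁₀ (hq₁₀.trans_le hq) hgf hgf'
          (hmono t ht) φ
  · refine sInf_le_sInf ?_
    rintro _ ⟨φ, hφ, hK, rfl⟩
    exact ⟨φ, hφ, hK.le, by simp [Hfun, hK]⟩
end

section
/- Let d ≥ 1 be an integer, ε > 0, and let (α,β) ∈ ℝ² be admissible, with μ̄ := max(2α+dβ, 2α+(d−2)β). Let f : ℝ → ℝ be differentiable with f(u) ≥ 0 and u·f′(u) ≥ (2+4/d+ε)·f(u) for all u ∈ ℝ, and suppose there are C > 0 and 2 ≤ q₁ ≤ q₂ with |f(u)| + |u·f′(u)| ≤ C(|u|^{q₁}+|u|^{q₂}) for all u. Then for every real-valued Schwartz function φ on ℝ^d: μ̄·J(φ) − K_{α,β}(φ) ≥ αε·F(φ) + |β|·min(∫_{ℝ^d}φ² dx, ∫_{ℝ^d}|∇φ|² dx). -/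
open MeasureTheory

/-- A measurable function bounded by a sum of two powers of exponent at least two is integrable
when composed with a Schwartz function. -/
theorem SchwartzMap.integrable_comp_of_abs_le_rpow_add_rpow {E : Type*} [NormedAddCommGroup E]
    [NormedSpace ℝ E] [MeasurableSpace E] [BorelSpace E] [SecondCountableTopology E]
    (μ : Measure E) [μ.HasTemperateGrowth] {g : ℝ → ℝ} (hg : Measurable g)
    {C q₁ q₂ : ℝ} (hC : 0 ≤ C) (hq₁ : 2 ≤ q₁) (hq₂ : 2 ≤ q₂)
    (hbound : ∀ u : ℝ, |g u| ≤ C * (|u| ^ q₁ + |u| ^ q₂)) (φ : SchwartzMap E ℝ) :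
    Integrable (fun x => g (φ x)) μ := by
  obtain ⟨M, -, hM⟩ := φ.decay 0 0
  simp only [pow_zero, one_mul, norm_iteratedFDeriv_zero, Real.norm_eq_abs] at hM
  have hpow (x : E) {q : ℝ} (hq : 2 ≤ q) : |φ x| ^ q ≤ φ x ^ 2 * M ^ (q - 2) := by
    have hsplit : |φ x| ^ q = φ x ^ 2 * |φ x| ^ (q - 2) := by
      rw [← sq_abs (φ x), ← Real.rpow_natCast |φ x| 2,
        ← Real.rpow_add_of_nonneg (abs_nonneg _) (by norm_num) (by linarith)]
      norm_num
    rw [hsplit]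
    exact mul_le_mul_of_nonneg_left
      (Real.rpow_le_rpow (abs_nonneg _) (hM x) (by linarith)) (sq_nonneg _)
  have hsq : Integrable (fun x => φ x ^ 2) μ := (φ.memLp 2 μ).integrable_sq
  refine (hsq.const_mul (C * (M ^ (q₁ - 2) + M ^ (q₂ - 2)))).mono'
    (hg.comp φ.continuous.measurable).aestronglyMeasurable (Filter.Eventually.of_forall fun x => ?_)
  calc ‖g (φ x)‖ ≤ C * (|φ x| ^ q₁ + |φ x| ^ q₂) := hbound _
    _ ≤ C * (φ x ^ 2 * M ^ (q₁ - 2) + φ x ^ 2 * M ^ (q₂ - 2)) :=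
      mul_le_mul_of_nonneg_left (add_le_add (hpow x hq₁) (hpow x hq₂)) hC
    _ = C * (M ^ (q₁ - 2) + M ^ (q₂ - 2)) * φ x ^ 2 := by ring

theorem stmt11 (d : ℕ) (hd : 1 ≤ d) (ε α β : ℝ) (hε : 0 < ε)
    (hα : 0 ≤ α) (h1 : 0 ≤ 2*α + (d:ℝ)*β) (h2 : 0 ≤ 2*α + ((d:ℝ)-2)*β)
    (hne : (α, β) ≠ (0, 0))
    (f : ℝ → ℝ) (hf : Differentiable ℝ f)
    (hpos : ∀ u : ℝ, 0 ≤ f u)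
    (hD : ∀ u : ℝ, (2 + 4/(d:ℝ) + ε) * f u ≤ u * deriv f u)
    (C q₁ q₂ : ℝ) (hC : 0 < C) (hq1 : 2 ≤ q₁) (hq12 : q₁ ≤ q₂)
    (hbound : ∀ u : ℝ, |f u| + |u * deriv f u| ≤ C * (|u| ^ q₁ + |u| ^ q₂)) :
    ∀ φ : SchwartzMap (EuclideanSpace ℝ (Fin d)) ℝ,
      α * ε * (∫ x, f (φ x))
          + |β| * min (∫ x, (φ x)^2) (∫ x, ‖fderiv ℝ (⇑φ) x‖^2)
        ≤ max (2*α + (d:ℝ)*β) (2*α + ((d:ℝ)-2)*β)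
            * ((1/2) * (∫ x, (‖fderiv ℝ (⇑φ) x‖^2 + (φ x)^2)) - (∫ x, f (φ x)))
          - (((2*α + ((d:ℝ)-2)*β)/2) * (∫ x, ‖fderiv ℝ (⇑φ) x‖^2)
              + ((2*α + (d:ℝ)*β)/2) * (∫ x, (φ x)^2)
              - (∫ x, (α * φ x * deriv f (φ x) + (d:ℝ)*β * f (φ x)))) := by
  intro φ
  have hA : Integrable (fun x => ‖fderiv ℝ (⇑φ) x‖ ^ 2) :=
    ((SchwartzMap.fderivCLM ℝ (EuclideanSpace ℝ (Fin d)) ℝ φ).memLp 2 volume).integrable_norm_pow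
      two_ne_zero
  have hB : Integrable (fun x => φ x ^ 2) := (φ.memLp 2 volume).integrable_sq
  have hF : Integrable (fun x => f (φ x)) :=
    φ.integrable_comp_of_abs_le_rpow_add_rpow volume hf.continuous.measurable hC.le hq1
      (hq1.trans hq12) fun u => by linarith [hbound u, abs_nonneg (u * deriv f u)]
  have hG : Integrable (fun x => φ x * deriv f (φ x)) :=
    φ.integrable_comp_of_abs_le_rpow_add_rpow (g := fun u => u * deriv f u) volume
      (measurable_id.mul (measurable_deriv f)) hC.le hq1
      (hq1.trans hq12) fun u => by linarith [hbound u, abs_nonneg (f u)]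
  have hGF : (2 + 4 / (d : ℝ) + ε) * ∫ x, f (φ x) ≤ ∫ x, φ x * deriv f (φ x) := by
    rw [← integral_const_mul]
    exact integral_mono (hF.const_mul _) hG fun x => hD (φ x)
  have hF0 : 0 ≤ ∫ x, f (φ x) := integral_nonneg fun x => hpos _
  have hsplit : ∫ x, (α * φ x * deriv f (φ x) + (d : ℝ) * β * f (φ x)) =
      α * (∫ x, φ x * deriv f (φ x)) + (d : ℝ) * β * ∫ x, f (φ x) := by
    rw [← integral_const_mul, ← integral_const_mul,
      ← integral_add (hG.const_mul _) (hF.const_mul _)]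
    simp only [mul_assoc]
  rw [hsplit, integral_add hA hB]
  generalize (∫ x, f (φ x)) = F at *
  generalize (∫ x, φ x * deriv f (φ x)) = G at *
  generalize (∫ x, ‖fderiv ℝ (⇑φ) x‖ ^ 2) = A
  generalize (∫ x, φ x ^ 2) = B
  have hd0 : (0 : ℝ) < d := by exact_mod_cast hd
  have hαG := mul_le_mul_of_nonneg_left hGF hα
  rcases le_total 0 β with hβ | hβ
  · rw [max_eq_left (by linarith), abs_of_nonneg hβ]
    have hmin := mul_le_mul_of_nonneg_left (min_le_right B A) hβ
    have hrest : 0 ≤ α * (4 / (d : ℝ)) * F := by positivity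
    linarith
  · rw [max_eq_right (by linarith), abs_of_nonpos hβ]
    have hmin := mul_le_mul_of_nonneg_left (min_le_left B A) (neg_nonneg.2 hβ)
    have hcoef : 0 ≤ α * (4 / (d : ℝ)) + 2 * β := by
      have : α * (4 / (d : ℝ)) + 2 * β = 2 / d * (2 * α + d * β) := by field_simp; ring
      rw [this]
      positivity
    have hrest := mul_nonneg hcoef hF0
    linarith
end

section
/- Let d ≥ 1 be an integer and let f : ℝ → ℝ be continuously differentiable with f(0) = 0 and |f(u)| + |u·f′(u)| ≤ C(|u|² + |u|^q) for all u, for some C > 0 and q ≥ 2. Let Q be a real-valued Schwartz function on ℝ^d solving −ΔQ(x) + Q(x) = f′(Q(x)) for every x ∈ ℝ^d. Then ∫_{ℝ^d}(|∇Q|² + Q²) dx = ∫_{ℝ^d} Q·f′(Q) dx (Nehari identity) and ((d−2)/2)∫_{ℝ^d}|∇Q|² dx + (d/2)∫_{ℝ^d}Q² dx = d·∫_{ℝ^d} f(Q) dx (Pohozaev identity); consequently K_{α,β}(Q) = 0 for every (α,β) ∈ ℝ², where K_{α,β}(Q) := ((2α+(d−2)β)/2)∫|∇Q|² dx + ((2α+dβ)/2)∫Q²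 dx − ∫(α·Q·f′(Q) + dβ·f(Q)) dx. -/
/-- The Laplacian on `ℝ^d` as a sum of second directional derivatives. -/
noncomputable def lap (d : ℕ) (u : EuclideanSpace ℝ (Fin d) → ℝ)
    (x : EuclideanSpace ℝ (Fin d)) : ℝ :=
  ∑ i : Fin d,
    fderiv ℝ (fun y => fderiv ℝ u y (EuclideanSpace.single i 1)) x
      (EuclideanSpace.single i 1)

open MeasureTheory SchwartzMap LineDeriv

section Pohozaev

variable {E : Type*} [NormedAddCommGroup E]

lemma SchwartzMap.lineDerivOp_comm [NormedSpace ℝ E] (v w : E) (g : SchwartzMap E ℝ) :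
    ∂_{v} (∂_{w} g) = ∂_{w} (∂_{v} g) := by
  ext x
  have h (a b : E) : (∂_{a} (∂_{b} g)) x = fderiv ℝ (fderiv ℝ g) x a b := by
    rw [lineDerivOp_apply_eq_fderiv]
    have hd : DifferentiableAt ℝ (fderiv ℝ g) x :=
      ((g.smooth 2).fderiv_right (m := 1) le_rfl).differentiable one_ne_zero x
    have : ⇑(∂_{b} g : SchwartzMap E ℝ) = fun y => fderiv ℝ g y b := rfl
    rw [this, fderiv_clm_apply hd (differentiableAt_const b)]
    simp
  rw [h, h]
  exact ((g.smooth 2).contDiffAt.isSymmSndFDerivAt (by simp)) v w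

lemma SchwartzMap.lineDerivOp_smulLeftCLM_clm [NormedSpace ℝ E] (l : E →L[ℝ] ℝ) (v : E)
    (g : SchwartzMap E ℝ) (x : E) :
    ∂_{v} (smulLeftCLM ℝ l g) x = l v * g x + l x * ∂_{v} g x := by
  rw [lineDerivOp_apply_eq_fderiv, smulLeftCLM_apply l.hasTemperateGrowth]
  have := (l.hasFDerivAt (x := x)).mul (g.hasFDerivAt x)
  change fderiv ℝ (⇑l * ⇑g) x v = _
  rw [this.fderiv]
  simp [lineDerivOp_apply_eq_fderiv]
  ring

lemma SchwartzMap.exists_forall_abs_le [NormedSpace ℝ E] (g : SchwartzMap E ℝ) :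
    ∃ M, ∀ x, |g x| ≤ M :=
  ⟨_, fun x => norm_le_seminorm ℝ g x⟩

lemma SchwartzMap.exists_forall_abs_comp_le [NormedSpace ℝ E] {φ : ℝ → ℝ} (hφ : Continuous φ)
    (g : SchwartzMap E ℝ) : ∃ M, ∀ x, |φ (g x)| ≤ M := by
  obtain ⟨M, hM⟩ := g.exists_forall_abs_le
  obtain ⟨K, hK⟩ := (isCompact_Icc (a := -M) (b := M)).exists_bound_of_continuousOn hφ.continuousOn
  exact ⟨K, fun x => hK _ (abs_le.mp (hM x))⟩

lemma exists_abs_le_mul_sq_of_abs_le {f : ℝ → ℝ} {C q : ℝ} (hC : 0 ≤ C) (hq : 2 ≤ q)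
    (hf : ∀ u, |f u| ≤ C * (|u| ^ (2 : ℝ) + |u| ^ q)) (M : ℝ) :
    ∃ K, ∀ u, |u| ≤ M → |f u| ≤ K * u ^ 2 := by
  refine ⟨C * (1 + M ^ (q - 2)), fun u hu => (hf u).trans ?_⟩
  have h : |u| ^ q = u ^ 2 * |u| ^ (q - 2) := by
    rw [← sq_abs, ← Real.rpow_two, ← Real.rpow_add_of_nonneg (abs_nonneg u) two_pos.le
      (sub_nonneg.mpr hq), add_sub_cancel]
  have hM : |u| ^ (q - 2) ≤ M ^ (q - 2) :=
    Real.rpow_le_rpow (abs_nonneg u) hu (sub_nonneg.mpr hq)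
  rw [h, Real.rpow_two, sq_abs, mul_assoc]
  refine mul_le_mul_of_nonneg_left ?_ hC
  nlinarith [mul_le_mul_of_nonneg_left hM (sq_nonneg u)]

variable [NormedSpace ℝ E] [FiniteDimensional ℝ E] [MeasurableSpace E] [BorelSpace E]
  {μ : Measure E} [μ.IsAddHaarMeasure]

lemma SchwartzMap.integrable_mul (g h : SchwartzMap E ℝ) :
    Integrable (fun x => g x * h x) μ :=
  (pairing (ContinuousLinearMap.mul ℝ ℝ) g h).integrable

lemma SchwartzMap.integrable_clm_mul (l : E →L[ℝ] ℝ) (g : SchwartzMap E ℝ) :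
    Integrable (fun x => l x * g x) μ := by
  have := (smulLeftCLM ℝ l g).integrable (μ := μ)
  simpa [smulLeftCLM_apply l.hasTemperateGrowth] using this

lemma SchwartzMap.integrable_clm_mul_mul (l : E →L[ℝ] ℝ) (g h : SchwartzMap E ℝ) :
    Integrable (fun x => l x * g x * h x) μ := by
  have := (smulLeftCLM ℝ l g).integrable_mul h (μ := μ)
  simpa [smulLeftCLM_apply l.hasTemperateGrowth] using this

lemma SchwartzMap.integral_clm_mul_lineDerivOp_self (l : E →L[ℝ] ℝ) (v : E)
    (g : SchwartzMap E ℝ) :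
    ∫ x, l x * g x * ∂_{v} g x ∂μ = -(l v / 2) * ∫ x, g x ^ 2 ∂μ := by
  have key := integral_mul_lineDerivOp_right_eq_neg_left (μ := μ) (smulLeftCLM ℝ l g) g v
  simp only [lineDerivOp_smulLeftCLM_clm, smulLeftCLM_apply_apply l.hasTemperateGrowth,
    smul_eq_mul] at key
  have h : ∫ x, (l v * g x + l x * ∂_{v} g x) * g x ∂μ
      = l v * ∫ x, g x ^ 2 ∂μ + ∫ x, l x * g x * ∂_{v} g x ∂μ := by
    rw [← integral_const_mul, ← integral_add _ (integrable_clm_mul_mul l g _)]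
    · congr 1; ext x; ring
    · simpa only [sq] using (g.integrable_mul g).const_mul _
  linarith

lemma SchwartzMap.integral_clm_mul_lineDerivOp_mul_lineDerivOp_lineDerivOp (l : E →L[ℝ] ℝ)
    (v w : E) (g : SchwartzMap E ℝ) :
    ∫ x, l x * ∂_{v} g x * ∂_{w} (∂_{w} g) x ∂μ
      = (l v / 2) * ∫ x, (∂_{w} g x) ^ 2 ∂μ - l w * ∫ x, ∂_{v} g x * ∂_{w} g x ∂μ := by
  have key := integral_mul_lineDerivOp_right_eq_neg_left (μ := μ)
    (smulLeftCLM ℝ l (∂_{v} g)) (∂_{w} g) w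
  simp only [lineDerivOp_smulLeftCLM_clm, smulLeftCLM_apply_apply l.hasTemperateGrowth,
    smul_eq_mul] at key
  have h : ∫ x, (l w * ∂_{v} g x + l x * ∂_{w} (∂_{v} g) x) * ∂_{w} g x ∂μ
      = l w * ∫ x, ∂_{v} g x * ∂_{w} g x ∂μ
        + ∫ x, l x * ∂_{w} g x * ∂_{v} (∂_{w} g) x ∂μ := by
    rw [lineDerivOp_comm w v, ← integral_const_mul,
      ← integral_add ((integrable_mul _ _).const_mul _) (integrable_clm_mul_mul l _ _)]
    congr 1; ext x; ring
  rw [integral_clm_mul_lineDerivOp_self l v (∂_{w} g)] at h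
  linarith

lemma SchwartzMap.integrable_comp_of_abs_le {f : ℝ → ℝ} (hf : Continuous f)
    {K : ℝ} (g : SchwartzMap E ℝ) (hK : ∀ x, |f (g x)| ≤ K * g x ^ 2) :
    Integrable (fun x => f (g x)) μ := by
  refine Integrable.mono' (g := fun x => K * (g x * g x)) ((g.integrable_mul g).const_mul K)
    (hf.comp g.continuous).aestronglyMeasurable (.of_forall fun x => ?_)
  simpa [sq] using hK x

lemma SchwartzMap.integral_clm_mul_deriv_comp_mul_lineDerivOp {f : ℝ → ℝ} (hf : ContDiff ℝ 1 f)
    {K : ℝ} (g : SchwartzMap E ℝ) (hK : ∀ x, |f (g x)| ≤ K * g x ^ 2)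
    (l : E →L[ℝ] ℝ) (v : E) :
    ∫ x, l x * (deriv f (g x) * ∂_{v} g x) ∂μ = -(l v * ∫ x, f (g x) ∂μ) := by
  have hint : Integrable (fun x => f (g x)) μ := g.integrable_comp_of_abs_le hf.continuous hK
  have hlint : Integrable (fun x => l x * f (g x)) μ := by
    refine Integrable.mono' (g := fun x => K * |l x * g x * g x|)
      ((g.integrable_clm_mul_mul l g).abs.const_mul K)
      (l.continuous.mul (hf.continuous.comp g.continuous)).aestronglyMeasurable
      (.of_forall fun x => ?_)
    have := mul_le_mul_of_nonneg_left (hK x) (abs_nonneg (l x))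
    rw [Real.norm_eq_abs, abs_mul, mul_assoc, abs_mul, abs_mul_self]
    linarith
  have hd (x : E) : HasFDerivAt (fun y => f (g y)) (deriv f (g x) • fderiv ℝ g x) x :=
    ((hf.differentiable one_ne_zero (g x)).hasDerivAt).comp_hasFDerivAt x (g.hasFDerivAt x)
  have hd' (x : E) : fderiv ℝ (fun y => f (g y)) x v = deriv f (g x) * ∂_{v} g x := by
    rw [(hd x).fderiv]; rfl
  have hdint : Integrable (fun x => l x * (deriv f (g x) * ∂_{v} g x)) μ := by
    have hf' : Continuous (deriv f) := hf.continuous_deriv le_rfl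
    obtain ⟨M, hM⟩ := g.exists_forall_abs_comp_le hf'
    convert! ((∂_{v} g).integrable_clm_mul l (μ := μ)).bdd_mul (c := M)
      (hf'.comp g.continuous).aestronglyMeasurable (.of_forall hM) using 2
    simp only [Function.comp_apply]; ring
  have key := integral_mul_fderiv_eq_neg_fderiv_mul_of_integrable (μ := μ) (f := l)
    (g := fun y => f (g y)) (v := v) (by simpa using hint.const_mul (l v))
    (by simpa only [hd'] using hdint) hlint
    (fun x _ => l.differentiableAt) (fun x _ => (hd x).differentiableAt)
  simpa only [hd', ContinuousLinearMap.fderiv, integral_const_mul] using key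

end Pohozaev


theorem stmt16 (d : ℕ) (hd : 1 ≤ d)
    (f : ℝ → ℝ) (hf : ContDiff ℝ 1 f) (hf0 : f 0 = 0)
    (C q : ℝ) (hC : 0 < C) (hq : 2 ≤ q)
    (hbound : ∀ u : ℝ, |f u| + |u * deriv f u| ≤ C * (|u| ^ (2:ℝ) + |u| ^ q))
    (Q : SchwartzMap (EuclideanSpace ℝ (Fin d)) ℝ)
    (hQ : ∀ x, -lap d (⇑Q) x + Q x = deriv f (Q x)) :
    ((∫ x, (‖fderiv ℝ (⇑Q) x‖^2 + (Q x)^2)) = ∫ x, Q x * deriv f (Q x))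
    ∧ ((((d:ℝ)-2)/2) * (∫ x, ‖fderiv ℝ (⇑Q) x‖^2) + ((d:ℝ)/2) * (∫ x, (Q x)^2)
        = (d:ℝ) * ∫ x, f (Q x))
    ∧ (∀ α β : ℝ,
        ((2*α + ((d:ℝ)-2)*β)/2) * (∫ x, ‖fderiv ℝ (⇑Q) x‖^2)
          + ((2*α + (d:ℝ)*β)/2) * (∫ x, (Q x)^2)
          - (∫ x, (α * Q x * deriv f (Q x) + (d:ℝ)*β * f (Q x))) = 0) := by
  obtain ⟨M, hM⟩ := Q.exists_forall_abs_le
  obtain ⟨K, hK⟩ := exists_abs_le_mul_sq_of_abs_le hC.le hq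
    (fun u => (le_add_of_nonneg_right (abs_nonneg _)).trans (hbound u)) M
  have hK (x) : |f (Q x)| ≤ K * Q x ^ 2 := hK _ (hM x)
  let e (i : Fin d) : EuclideanSpace ℝ (Fin d) := EuclideanSpace.single i 1
  have hlap (x) : lap d Q x = ∑ i, ∂_{e i} (∂_{e i} Q) x := rfl
  have hQ' (x) : deriv f (Q x) = Q x - ∑ i, ∂_{e i} (∂_{e i} Q) x := by
    rw [← hQ x, hlap]; ring
  have hgrad (x) : ‖fderiv ℝ Q x‖ ^ 2 = ∑ i, (∂_{e i} Q x) ^ 2 := by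
    simpa [e, lineDerivOp_apply_eq_fderiv] using
      (EuclideanSpace.basisFun (Fin d) ℝ).norm_dual (fderiv ℝ Q x)
  have hsq (g : SchwartzMap (EuclideanSpace ℝ (Fin d)) ℝ) : Integrable (fun x => g x ^ 2) := by
    simpa only [sq] using g.integrable_mul g
  have hgradint : ∫ x, ‖fderiv ℝ Q x‖ ^ 2 = ∑ i, ∫ x, (∂_{e i} Q x) ^ 2 := by
    simp_rw [hgrad]
    exact integral_finsetSum _ fun i _ => hsq _
  have hgradI : Integrable (fun x => ‖fderiv ℝ Q x‖ ^ 2) := by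
    simp_rw [hgrad]
    exact integrable_finsetSum _ fun i _ => hsq _
  have hfI : Integrable (fun x => f (Q x)) := Q.integrable_comp_of_abs_le hf.continuous hK
  have hexp (x) : Q x * deriv f (Q x) = Q x ^ 2 - ∑ i, Q x * ∂_{e i} (∂_{e i} Q) x := by
    rw [hQ', mul_sub, Finset.mul_sum, sq]
  have hlapI : Integrable (fun x => ∑ i, Q x * ∂_{e i} (∂_{e i} Q) x) :=
    integrable_finsetSum _ fun i _ => Q.integrable_mul _
  have hQfI : Integrable (fun x => Q x * deriv f (Q x)) := by
    simp_rw [hexp]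
    exact (hsq Q).sub hlapI
  have nehari : ∫ x, Q x * deriv f (Q x)
      = (∫ x, ‖fderiv ℝ Q x‖ ^ 2) + ∫ x, Q x ^ 2 := by
    simp_rw [hexp]
    rw [integral_sub (hsq Q) hlapI, integral_finsetSum _ fun i _ => Q.integrable_mul _, hgradint]
    have hi (i : Fin d) : ∫ x, Q x * ∂_{e i} (∂_{e i} Q) x = -∫ x, (∂_{e i} Q x) ^ 2 := by
      rw [integral_mul_lineDerivOp_right_eq_neg_left]
      simp only [sq]
    simp_rw [hi, Finset.sum_neg_distrib]
    ring
  have pohozaev : (((d:ℝ)-2)/2) * (∫ x, ‖fderiv ℝ Q x‖^2) + ((d:ℝ)/2) * (∫ x, (Q x)^2)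
      = (d:ℝ) * ∫ x, f (Q x) := by
    let l (i : Fin d) : EuclideanSpace ℝ (Fin d) →L[ℝ] ℝ := EuclideanSpace.proj i
    have hl (i j : Fin d) : l i (e j) = if i = j then 1 else 0 := by
      simp [l, e, PiLp.single_apply]
    have hi (i : Fin d) : ∫ x, f (Q x) = (1 / 2) * (∫ x, Q x ^ 2)
        + (1 / 2) * (∫ x, ‖fderiv ℝ Q x‖ ^ 2) - ∫ x, (∂_{e i} Q x) ^ 2 := by
      have h1 := Q.integral_clm_mul_deriv_comp_mul_lineDerivOp (μ := volume) hf hK (l i) (e i)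
      have h2 (x) : l i x * (deriv f (Q x) * ∂_{e i} Q x) = l i x * Q x * ∂_{e i} Q x
          - ∑ j, l i x * ∂_{e i} Q x * ∂_{e j} (∂_{e j} Q) x := by
        rw [hQ', ← Finset.mul_sum]; ring
      simp_rw [h2] at h1
      rw [integral_sub (integrable_clm_mul_mul _ _ _)
        (integrable_finsetSum _ fun j _ => integrable_clm_mul_mul _ _ _),
        integral_finsetSum _ fun j _ => integrable_clm_mul_mul _ _ _,
        integral_clm_mul_lineDerivOp_self] at h1
      simp_rw [integral_clm_mul_lineDerivOp_mul_lineDerivOp_lineDerivOp, Finset.sum_sub_distrib,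
        ← Finset.mul_sum, ← hgradint, hl, ite_mul, zero_mul] at h1
      simp only [Finset.sum_ite_eq, Finset.mem_univ, if_true, one_mul, ← sq] at h1
      linarith
    have hsum := Finset.sum_congr rfl fun i (_ : i ∈ Finset.univ) => hi i
    rw [Finset.sum_sub_distrib, ← hgradint] at hsum
    simp only [Finset.sum_const, Finset.card_univ, Fintype.card_fin, nsmul_eq_mul] at hsum
    linarith
  refine ⟨?_, pohozaev, fun α β => ?_⟩
  · rw [integral_add hgradI (hsq Q), nehari]
  · simp_rw [mul_assoc α]
    rw [integral_add (hQfI.const_mul α) (hfI.const_mul _), integral_const_mul,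
      integral_const_mul, nehari]
    linear_combination β * pohozaev
end

section
/- Let d ≥ 3 be an integer, write 2^⋆ := 2 + 4/(d−2) = 2d/(d−2), and let (α,β) ∈ ℝ² be admissible. For real-valued Schwartz functions φ on ℝ^d define J(φ) := (1/2)∫(|∇φ|² + φ²) dx − (1/2^⋆)∫|φ|^{2^⋆} dx and K_{α,β}(φ) := ((2α+(d−2)β)/2)∫|∇φ|² dx + ((2α+dβ)/2)∫φ² dx − (α + dβ/2^⋆)·∫|φ|^{2^⋆} dx. Let C_S := sup{ (∫|φ|^{2^⋆} dx)^{1/2^⋆} / (∫|∇φ|² dx)^{1/2} : φ Schwartz, φ ≢ 0 } (a finite positive real by the Sobolev inequality). Then inf{ J(φ) : φ Schwartz, φ ≢ 0, K_{α,β}(φ) = 0 } = (1/d)·C_S^{−d}; in particular this infimum is positive and independent of the admissible pair (α,β). -/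
open MeasureTheory Filter Topology
open scoped ENNReal NNReal SchwartzMap ContDiff

section Sobolev

variable {E : Type*} [NormedAddCommGroup E] [NormedSpace ℝ E]

/-- A pointwise bound for the derivative of a function times a dilated cutoff. -/
theorem norm_fderiv_mul_comp_smul_le {χ φ : E → ℝ} (hχ : Differentiable ℝ χ)
    (hφ : Differentiable ℝ φ) {D : ℝ} (hχ1 : ∀ x, |χ x| ≤ 1) (hD : ∀ x, ‖fderiv ℝ χ x‖ ≤ D)
    {c : ℝ} (hc : 0 ≤ c) (x : E) :
    ‖fderiv ℝ (fun y => χ (c • y) * φ y) x‖ ≤ ‖fderiv ℝ φ x‖ + c * D * ‖φ x‖ := by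
  have hd : DifferentiableAt ℝ (fun y => χ (c • y)) x :=
    (hχ (c • x)).comp x (differentiableAt_id.const_smul c)
  rw [fderiv_fun_mul hd (hφ x), fderiv_comp_smul]
  refine (norm_add_le _ _).trans (add_le_add ?_ ?_)
  · rw [norm_smul]
    exact mul_le_of_le_one_left (norm_nonneg _) (hχ1 _)
  · rw [norm_smul, norm_smul, Real.norm_of_nonneg hc, mul_comm]
    gcongr
    exact hD _

variable [FiniteDimensional ℝ E] [MeasurableSpace E] [BorelSpace E]

/-- The Gagliardo–Nirenberg–Sobolev inequality for Schwartz functions. -/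
theorem SchwartzMap.eLpNorm_le_eLpNorm_fderiv_of_eq (μ : Measure E) [μ.IsAddHaarMeasure]
    {p p' : ℝ≥0} (hp : 1 ≤ p) (hn : 0 < Module.finrank ℝ E)
    (hp' : (p' : ℝ)⁻¹ = (p : ℝ)⁻¹ - (Module.finrank ℝ E : ℝ)⁻¹) (φ : 𝓢(E, ℝ)) :
    eLpNorm φ p' μ ≤ SNormLESNormFDerivOfEqConst ℝ μ p * eLpNorm (fderiv ℝ φ) p μ := by
  let χ : ContDiffBump (0 : E) := ⟨1, 2, one_pos, one_lt_two⟩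
  have hχd : ContDiff ℝ ∞ χ := χ.contDiff
  obtain ⟨D, hD⟩ := (χ.hasCompactSupport.fderiv ℝ).exists_bound_of_continuous
    (hχd.continuous_fderiv (by simp))
  have hD0 : 0 ≤ D := (norm_nonneg _).trans (hD 0)
  let c : ℕ → ℝ := fun n => 1 / ((n : ℝ) + 1)
  have hc (n : ℕ) : 0 < c n := Nat.one_div_pos_of_nat
  have hclim : Tendsto c atTop (𝓝 0) := tendsto_one_div_add_atTop_nhds_zero_nat
  let u : ℕ → E → ℝ := fun n x => χ (c n • x) * φ x
  have hφd : ContDiff ℝ ∞ φ := φ.smooth ⊤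
  have hud (n : ℕ) : ContDiff ℝ 1 (u n) :=
    ((hχd.comp (contDiff_const_smul (c n))).mul hφd).of_le (by simp)
  have hus (n : ℕ) : HasCompactSupport (u n) :=
    (χ.hasCompactSupport.comp_homeomorph (Homeomorph.smulOfNeZero (c n) (hc n).ne')).mul_right
  have hlim (x : E) : Tendsto (fun n => u n x) atTop (𝓝 (φ x)) := by
    have h : Tendsto (fun n => c n • x) atTop (𝓝 0) := by
      simpa using hclim.smul_const x
    have h1 := h.eventually χ.eventuallyEq_one
    refine tendsto_const_nhds.congr' ?_
    filter_upwards [h1] with n hn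
    simp [u, hn]
  have hfm : AEStronglyMeasurable (fun x => ‖fderiv ℝ φ x‖) μ :=
    (hφd.continuous_fderiv (by simp)).norm.aestronglyMeasurable
  have hbound (n : ℕ) : eLpNorm (u n) p' μ ≤ SNormLESNormFDerivOfEqConst ℝ μ p *
      (eLpNorm (fderiv ℝ φ) p μ + ‖c n * D‖ₑ * eLpNorm φ p μ) := by
    refine (MeasureTheory.eLpNorm_le_eLpNorm_fderiv_of_eq μ (hud n) (hus n) hp hn hp').trans ?_
    gcongr
    have h1 : eLpNorm (fderiv ℝ (u n)) p μ ≤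
        eLpNorm ((fun x => ‖fderiv ℝ φ x‖) + (c n * D) • fun x => ‖φ x‖) p μ :=
      eLpNorm_mono_real fun x => norm_fderiv_mul_comp_smul_le (hχd.differentiable (by simp))
        (hφd.differentiable (by simp))
        (fun y => by rw [abs_of_nonneg χ.nonneg]; exact χ.le_one) hD (hc n).le x
    refine h1.trans ((eLpNorm_add_le hfm
      (φ.continuous.norm.aestronglyMeasurable.const_smul _) (by exact_mod_cast hp)).trans ?_)
    rw [eLpNorm_const_smul, eLpNorm_norm, eLpNorm_norm]
  have hcD : Tendsto (fun n => ‖c n * D‖ₑ) atTop (𝓝 0) := by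
    have h := (hclim.mul_const D).enorm
    simpa using h
  have hrhs : Tendsto (fun n => SNormLESNormFDerivOfEqConst ℝ μ p *
      (eLpNorm (fderiv ℝ φ) p μ + ‖c n * D‖ₑ * eLpNorm φ p μ)) atTop
      (𝓝 (SNormLESNormFDerivOfEqConst ℝ μ p * eLpNorm (fderiv ℝ φ) p μ)) := by
    have h := ENNReal.Tendsto.mul_const hcD (Or.inr (φ.eLpNorm_lt_top p μ).ne)
    have h2 := ENNReal.Tendsto.const_mul (a := SNormLESNormFDerivOfEqConst ℝ μ p)
      (h.const_add (eLpNorm (fderiv ℝ φ) p μ)) (Or.inr ENNReal.coe_ne_top)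
    simpa using h2
  calc eLpNorm φ p' μ ≤ liminf (fun n => eLpNorm (u n) p' μ) atTop :=
        Lp.eLpNorm_lim_le_liminf_eLpNorm
          (fun n => (hud n).continuous.aestronglyMeasurable) _ (ae_of_all _ hlim)
    _ ≤ liminf (fun n => SNormLESNormFDerivOfEqConst ℝ μ p *
      (eLpNorm (fderiv ℝ φ) p μ + ‖c n * D‖ₑ * eLpNorm φ p μ)) atTop :=
        liminf_le_liminf (Eventually.of_forall hbound)
    _ = _ := hrhs.liminf_eq

end Sobolev

section Functionals

variable {d : ℕ}

/-- The squared `L²` norm of the gradient. -/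
noncomputable def gradSq (φ : 𝓢(EuclideanSpace ℝ (Fin d), ℝ)) : ℝ := ∫ x, ‖fderiv ℝ φ x‖ ^ 2

/-- The squared `L²` norm. -/
noncomputable def massSq (φ : 𝓢(EuclideanSpace ℝ (Fin d), ℝ)) : ℝ := ∫ x, φ x ^ 2

/-- The integral of `|φ|` to the power of the critical Sobolev exponent. -/
noncomputable def critPow (φ : 𝓢(EuclideanSpace ℝ (Fin d), ℝ)) : ℝ :=
  ∫ x, |φ x| ^ ((2 * (d : ℝ)) / ((d : ℝ) - 2))

/-- The quotient whose supremum is the best Sobolev constant. -/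
noncomputable def sobolevQuotient (φ : 𝓢(EuclideanSpace ℝ (Fin d), ℝ)) : ℝ :=
  critPow φ ^ (((d : ℝ) - 2) / (2 * (d : ℝ))) / gradSq φ ^ ((1 : ℝ) / 2)

theorem gradSq_nonneg (φ : 𝓢(EuclideanSpace ℝ (Fin d), ℝ)) : 0 ≤ gradSq φ :=
  integral_nonneg fun _ => by positivity

theorem massSq_nonneg (φ : 𝓢(EuclideanSpace ℝ (Fin d), ℝ)) : 0 ≤ massSq φ :=
  integral_nonneg fun _ => by positivity

theorem integrable_gradSq (φ : 𝓢(EuclideanSpace ℝ (Fin d), ℝ)) :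
    Integrable fun x => ‖fderiv ℝ φ x‖ ^ 2 :=
  ((SchwartzMap.fderivCLM ℝ _ _ φ).memLp 2 volume).integrable_norm_pow two_ne_zero

theorem integrable_massSq (φ : 𝓢(EuclideanSpace ℝ (Fin d), ℝ)) :
    Integrable fun x => φ x ^ 2 := by
  simpa using (φ.memLp 2).integrable_norm_pow two_ne_zero

theorem critPow_pos (hd : 3 ≤ d) {φ : 𝓢(EuclideanSpace ℝ (Fin d), ℝ)} (hφ : φ ≠ 0) :
    0 < critPow φ := by
  have hd' : (3 : ℝ) ≤ d := by exact_mod_cast hd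
  have hp : 0 < (2 * (d : ℝ)) / ((d : ℝ) - 2) := div_pos (by linarith) (by linarith)
  obtain ⟨x, hx⟩ : ∃ x, φ x ≠ 0 := by
    by_contra! h
    exact hφ (SchwartzMap.ext h)
  have hint : Integrable fun x => |φ x| ^ ((2 * (d : ℝ)) / ((d : ℝ) - 2)) := by
    have h := (φ.memLp (ENNReal.ofReal ((2 * (d : ℝ)) / ((d : ℝ) - 2)))).integrable_norm_rpow
      (by simpa using hp) ENNReal.ofReal_ne_top
    simpa [ENNReal.toReal_ofReal hp.le] using h
  refine integral_pos_of_integrable_nonneg_nonzero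
    (φ.continuous.abs.rpow_const fun _ => Or.inr hp.le) hint (fun _ => by positivity)
    (x := x) ?_
  exact (Real.rpow_pos_of_pos (abs_pos.2 hx) _).ne'

/-- The Sobolev inequality in terms of real-valued integrals. -/
theorem exists_critPow_rpow_le (hd : 3 ≤ d) :
    ∃ C : ℝ, ∀ φ : 𝓢(EuclideanSpace ℝ (Fin d), ℝ),
      critPow φ ^ (((d : ℝ) - 2) / (2 * (d : ℝ))) ≤ C * gradSq φ ^ ((1 : ℝ) / 2) := by
  have hd' : (3 : ℝ) ≤ d := by exact_mod_cast hd
  have hp : 0 < (2 * (d : ℝ)) / ((d : ℝ) - 2) := div_pos (by linarith) (by linarith)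
  let p' : ℝ≥0 := ⟨(2 * (d : ℝ)) / ((d : ℝ) - 2), hp.le⟩
  have hp'0 : p' ≠ 0 := fun h => hp.ne' (congrArg NNReal.toReal h)
  let C : ℝ≥0 := SNormLESNormFDerivOfEqConst ℝ
    (volume : Measure (EuclideanSpace ℝ (Fin d))) (2 : ℝ≥0)
  refine ⟨C, fun φ => ?_⟩
  have h : eLpNorm φ p' volume ≤ C * eLpNorm (fderiv ℝ φ) (2 : ℝ≥0) volume := φ.eLpNorm_le_eLpNorm_fderiv_of_eq volume (p := 2) (p' := p') one_le_two
    (by simp; omega) (by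
      simp only [finrank_euclideanSpace, Fintype.card_fin]
      change ((2 * (d : ℝ)) / ((d : ℝ) - 2))⁻¹ = 2⁻¹ - (d : ℝ)⁻¹
      have : (d : ℝ) - 2 ≠ 0 := by linarith
      have : (d : ℝ) ≠ 0 := by linarith
      field_simp)
  have hG : MemLp (fderiv ℝ φ) 2 volume := (SchwartzMap.fderivCLM ℝ _ _ φ).memLp 2 volume
  rw [(φ.memLp p' volume).eLpNorm_eq_integral_rpow_norm (by simpa using hp'0) ENNReal.coe_ne_top] at h
  rw [show ((2 : ℝ≥0) : ℝ≥0∞) = 2 from rfl,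
    hG.eLpNorm_eq_integral_rpow_norm two_ne_zero ENNReal.ofNat_ne_top,
    ← ENNReal.ofReal_coe_nnreal (p := C), ← ENNReal.ofReal_mul NNReal.zero_le_coe,
    ENNReal.ofReal_le_ofReal_iff (by positivity)] at h
  have hpe : ((p' : ℝ≥0∞)).toReal = (2 * (d : ℝ)) / ((d : ℝ) - 2) := rfl
  rw [hpe] at h
  simpa [critPow, gradSq] using h

theorem gradSq_pos (hd : 3 ≤ d) {φ : 𝓢(EuclideanSpace ℝ (Fin d), ℝ)} (hφ : φ ≠ 0) :
    0 < gradSq φ := by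
  obtain ⟨C, hC⟩ := exists_critPow_rpow_le hd
  refine (gradSq_nonneg φ).lt_of_ne' fun h => ?_
  have h1 := hC φ
  have h2 := Real.rpow_pos_of_pos (critPow_pos hd hφ) (((d : ℝ) - 2) / (2 * (d : ℝ)))
  rw [h, Real.zero_rpow (by norm_num), mul_zero] at h1
  linarith

theorem sobolevQuotient_pos (hd : 3 ≤ d) {φ : 𝓢(EuclideanSpace ℝ (Fin d), ℝ)} (hφ : φ ≠ 0) :
    0 < sobolevQuotient φ :=
  div_pos (Real.rpow_pos_of_pos (critPow_pos hd hφ) _) (Real.rpow_pos_of_pos (gradSq_pos hd hφ) _)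

theorem bddAbove_sobolevQuotient (hd : 3 ≤ d) :
    BddAbove {r : ℝ | ∃ φ : 𝓢(EuclideanSpace ℝ (Fin d), ℝ), φ ≠ 0 ∧ r = sobolevQuotient φ} := by
  obtain ⟨C, hC⟩ := exists_critPow_rpow_le hd
  refine ⟨C, ?_⟩
  rintro _ ⟨φ, hφ, rfl⟩
  exact (div_le_iff₀ (Real.rpow_pos_of_pos (gradSq_pos hd hφ) _)).2 (hC φ)

theorem exists_schwartzMap_ne_zero : ∃ φ : 𝓢(EuclideanSpace ℝ (Fin d), ℝ), φ ≠ 0 := by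
  let χ : ContDiffBump (0 : EuclideanSpace ℝ (Fin d)) := ⟨1, 2, one_pos, one_lt_two⟩
  refine ⟨χ.hasCompactSupport.toSchwartzMap χ.contDiff, fun h => ?_⟩
  have h0 : χ 0 = 0 := DFunLike.congr_fun h 0
  exact one_ne_zero ((χ.eventuallyEq_one.eq_of_nhds).symm.trans h0)

/-- The negative `d`-th power of the Sobolev quotient. -/
theorem sobolevQuotient_rpow_neg (hd : 3 ≤ d) {φ : 𝓢(EuclideanSpace ℝ (Fin d), ℝ)} (hφ : φ ≠ 0) :
    sobolevQuotient φ ^ (-(d : ℝ)) =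
      (gradSq φ / critPow φ) ^ (((d : ℝ) - 2) / 2) * gradSq φ := by
  have hd' : (3 : ℝ) ≤ d := by exact_mod_cast hd
  have hG := gradSq_pos hd hφ
  have hP := critPow_pos hd hφ
  rw [sobolevQuotient, Real.div_rpow (by positivity) (by positivity), ← Real.rpow_mul hP.le,
    ← Real.rpow_mul hG.le, Real.div_rpow hG.le hP.le,
    show ((d : ℝ) - 2) / (2 * d) * -d = -(((d : ℝ) - 2) / 2) by field_simp,
    show (1 : ℝ) / 2 * -d = -(((d : ℝ) - 2) / 2 + 1) by ring,
    Real.rpow_neg hP.le, Real.rpow_neg hG.le, Real.rpow_add_one hG.ne']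
  field_simp

/-- Rescaling `φ` in space by `r` with the amplitude tuned so that the critical term is
prescribed. -/
theorem exists_rescaling (hd : 3 ≤ d) {φ : 𝓢(EuclideanSpace ℝ (Fin d), ℝ)} (hφ : φ ≠ 0)
    {r N : ℝ} (hr : 0 < r) (hN : 0 < N) :
    ∃ u : 𝓢(EuclideanSpace ℝ (Fin d), ℝ), u ≠ 0 ∧
      gradSq u = (N / critPow φ) ^ (((d : ℝ) - 2) / 2) * gradSq φ ∧
      massSq u = (N / critPow φ) ^ (((d : ℝ) - 2) / 2) * (r ^ 2 * massSq φ) ∧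
      critPow u = (N / critPow φ) ^ (((d : ℝ) - 2) / 2) * N := by
  have hd' : (3 : ℝ) ≤ d := by exact_mod_cast hd
  have hd2 : (d : ℝ) - 2 ≠ 0 := by linarith
  have hP := critPow_pos hd hφ
  set q := N / critPow φ with hq
  have hq0 : 0 < q := div_pos hN hP
  set s : ℝ := (q / r ^ 2) ^ (((d : ℝ) - 2) / 4) with hs
  have hs0 : 0 < s := by positivity
  have hrd : (r ^ 2) ^ (((d : ℝ) - 2) / 2) * r ^ 2 = r ^ d := by
    rw [← Real.rpow_add_one (by positivity), ← Real.rpow_natCast r 2, ← Real.rpow_mul hr.le,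
      ← Real.rpow_natCast r d]
    congr 1
    push_cast
    ring
  have hs2 : s ^ 2 * r ^ d = q ^ (((d : ℝ) - 2) / 2) * r ^ 2 := by
    rw [hs, ← Real.rpow_natCast _ 2, ← Real.rpow_mul (by positivity),
      show ((d : ℝ) - 2) / 4 * (2 : ℕ) = ((d : ℝ) - 2) / 2 by push_cast; ring,
      Real.div_rpow hq0.le (by positivity), ← hrd]
    field_simp
  have hsp : s ^ ((2 * (d : ℝ)) / ((d : ℝ) - 2)) * r ^ d = q ^ (((d : ℝ) - 2) / 2) * q := by
    rw [hs, ← Real.rpow_mul (by positivity),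
      show ((d : ℝ) - 2) / 4 * ((2 * (d : ℝ)) / ((d : ℝ) - 2)) = ((d : ℝ) - 2) / 2 + 1 by
        field_simp; ring,
      Real.rpow_add_one (by positivity), Real.div_rpow hq0.le (by positivity), ← hrd]
    field_simp
  let e : EuclideanSpace ℝ (Fin d) ≃L[ℝ] EuclideanSpace ℝ (Fin d) :=
    ContinuousLinearEquiv.smulLeft (Units.mk0 r⁻¹ (inv_ne_zero hr.ne'))
  let u : 𝓢(EuclideanSpace ℝ (Fin d), ℝ) := s • SchwartzMap.compCLMOfContinuousLinearEquiv ℝ e φ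
  have hu (x) : u x = s * φ (r⁻¹ • x) := rfl
  have hdu (x) : fderiv ℝ u x = (s * r⁻¹) • fderiv ℝ φ (r⁻¹ • x) := by
    have : (u : EuclideanSpace ℝ (Fin d) → ℝ) = fun x => s • φ (r⁻¹ • x) := rfl
    rw [this, fderiv_fun_const_smul, fderiv_comp_smul, smul_smul]
    exact φ.differentiableAt.comp x (differentiableAt_id.const_smul r⁻¹)
  have hscale (k : ℝ) (f : EuclideanSpace ℝ (Fin d) → ℝ) :
      ∫ x, k * f (r⁻¹ • x) = k * (r ^ d * ∫ x, f x) := by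
    rw [integral_const_mul, Measure.integral_comp_inv_smul_of_nonneg volume f hr.le]
    simp
  have hcrit : critPow u = q ^ (((d : ℝ) - 2) / 2) * N := by
    have hN' : N = q * critPow φ := by rw [hq]; field_simp
    calc critPow u = s ^ ((2 * (d : ℝ)) / ((d : ℝ) - 2)) * (r ^ d * critPow φ) := by
          simp only [critPow, hu, abs_mul, abs_of_pos hs0, Real.mul_rpow hs0.le (abs_nonneg _)]
          exact hscale _ fun x => |φ x| ^ ((2 * (d : ℝ)) / ((d : ℝ) - 2))
      _ = _ := by rw [← mul_assoc, hsp, hN', mul_assoc]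
  refine ⟨u, ?_, ?_, ?_, hcrit⟩
  · intro h
    have h0 : critPow u = 0 := by
      have hp : (2 * (d : ℝ)) / ((d : ℝ) - 2) ≠ 0 := div_ne_zero (by linarith) hd2
      simp [critPow, h, Real.zero_rpow hp]
    exact (mul_pos (Real.rpow_pos_of_pos hq0 _) hN).ne' (hcrit.symm.trans h0)
  · calc gradSq u = (s * r⁻¹) ^ 2 * (r ^ d * gradSq φ) := by
          simp only [gradSq, hdu, norm_smul, Real.norm_eq_abs, mul_pow |s * r⁻¹|, sq_abs]
          exact hscale _ fun x => ‖fderiv ℝ φ x‖ ^ 2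
      _ = (s ^ 2 * r ^ d) * (r⁻¹) ^ 2 * gradSq φ := by ring
      _ = _ := by rw [hs2]; field_simp
  · calc massSq u = s ^ 2 * (r ^ d * massSq φ) := by
          simp only [massSq, hu, mul_pow]
          exact hscale _ fun x => φ x ^ 2
      _ = _ := by rw [← mul_assoc, hs2]; ring

end Functionals

theorem stmt17 (d : ℕ) (hd : 3 ≤ d) (α β : ℝ)
    (hα : 0 ≤ α) (h1 : 0 ≤ 2*α + (d:ℝ)*β) (h2 : 0 ≤ 2*α + ((d:ℝ)-2)*β)
    (hne : (α, β) ≠ (0, 0))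
    (CS : ℝ)
    (hCS : CS = sSup {r : ℝ | ∃ φ : SchwartzMap (EuclideanSpace ℝ (Fin d)) ℝ, φ ≠ 0 ∧
        r = (∫ x, |φ x| ^ ((2*(d:ℝ))/((d:ℝ)-2))) ^ (((d:ℝ)-2)/(2*(d:ℝ)))
            / (∫ x, ‖fderiv ℝ (⇑φ) x‖^2) ^ ((1:ℝ)/2)}) :
    0 < CS ∧
    sInf {m : ℝ | ∃ φ : SchwartzMap (EuclideanSpace ℝ (Fin d)) ℝ, φ ≠ 0 ∧
        (((2*α + ((d:ℝ)-2)*β)/2) * (∫ x, ‖fderiv ℝ (⇑φ) x‖^2)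
          + ((2*α + (d:ℝ)*β)/2) * (∫ x, (φ x)^2)
          - (α + (d:ℝ)*β/((2*(d:ℝ))/((d:ℝ)-2)))
            * (∫ x, |φ x| ^ ((2*(d:ℝ))/((d:ℝ)-2))) = 0) ∧
        m = (1/2) * (∫ x, (‖fderiv ℝ (⇑φ) x‖^2 + (φ x)^2))
          - (((d:ℝ)-2)/(2*(d:ℝ))) * (∫ x, |φ x| ^ ((2*(d:ℝ))/((d:ℝ)-2)))}
      = (1/(d:ℝ)) * CS ^ (-(d:ℝ)) := by
  have hd' : (3 : ℝ) ≤ d := by exact_mod_cast hd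
  have hd0 : (0 : ℝ) < d := by linarith
  have hd2 : (d : ℝ) - 2 ≠ 0 := by linarith
  have hquot : ∀ φ : 𝓢(EuclideanSpace ℝ (Fin d), ℝ), φ ≠ 0 → sobolevQuotient φ ≤ CS := by
    intro φ hφ
    rw [hCS]
    exact le_csSup (bddAbove_sobolevQuotient hd) ⟨φ, hφ, rfl⟩
  obtain ⟨φ₀, hφ₀⟩ := exists_schwartzMap_ne_zero (d := d)
  have hCS0 : 0 < CS := (sobolevQuotient_pos hd hφ₀).trans_le (hquot φ₀ hφ₀)
  refine ⟨hCS0, ?_⟩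
  set a := 2 * α + ((d : ℝ) - 2) * β with ha
  set b := 2 * α + (d : ℝ) * β with hb
  have hα_eq : α + (d : ℝ) * β / ((2 * (d : ℝ)) / ((d : ℝ) - 2)) = a / 2 := by
    rw [ha]; field_simp
  have ha0 : 0 < a := by
    refine h2.lt_of_ne' fun h => hne ?_
    have hβ : b = 2 * β := by linarith
    have h3 : 0 ≤ ((d : ℝ) - 2) * β := mul_nonneg (by linarith) (by linarith)
    have h4 : α = 0 := by linarith
    have h5 : ((d : ℝ) - 2) * β = 0 := by linarith
    rw [h4, (mul_eq_zero.1 h5).resolve_left hd2]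
  have hcoef : (d : ℝ) * a - ((d : ℝ) - 2) * b = 4 * α := by rw [ha, hb]; ring
  have hJ (φ : 𝓢(EuclideanSpace ℝ (Fin d), ℝ)) :
      ∫ x, (‖fderiv ℝ φ x‖ ^ 2 + φ x ^ 2) = gradSq φ + massSq φ :=
    integral_add (integrable_gradSq φ) (integrable_massSq φ)
  simp only [hJ, hα_eq]
  change sInf {m : ℝ | ∃ φ : 𝓢(EuclideanSpace ℝ (Fin d), ℝ), φ ≠ 0 ∧
    a / 2 * gradSq φ + b / 2 * massSq φ - a / 2 * critPow φ = 0 ∧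
    m = 1 / 2 * (gradSq φ + massSq φ) - ((d : ℝ) - 2) / (2 * (d : ℝ)) * critPow φ} = _
  set S := {m : ℝ | ∃ φ : 𝓢(EuclideanSpace ℝ (Fin d), ℝ), φ ≠ 0 ∧
    a / 2 * gradSq φ + b / 2 * massSq φ - a / 2 * critPow φ = 0 ∧
    m = 1 / 2 * (gradSq φ + massSq φ) - ((d : ℝ) - 2) / (2 * (d : ℝ)) * critPow φ} with hS
  have hlower : ∀ m ∈ S, 1 / (d : ℝ) * CS ^ (-(d : ℝ)) ≤ m := by
    rintro m ⟨φ, hφ, hK, rfl⟩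
    have hG := gradSq_pos hd hφ
    have hP := critPow_pos hd hφ
    have hM := massSq_nonneg φ
    have hPeq : critPow φ = gradSq φ + b / a * massSq φ := by
      field_simp
      linarith
    have hGP : gradSq φ ≤ critPow φ := by
      rw [hPeq]
      have : 0 ≤ b / a * massSq φ := by positivity
      linarith
    have hle : CS ^ (-(d : ℝ)) ≤ gradSq φ :=
      calc CS ^ (-(d : ℝ)) ≤ sobolevQuotient φ ^ (-(d : ℝ)) :=
            Real.rpow_le_rpow_of_nonpos (sobolevQuotient_pos hd hφ) (hquot φ hφ) (by linarith)
        _ = (gradSq φ / critPow φ) ^ (((d : ℝ) - 2) / 2) * gradSq φ :=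
            sobolevQuotient_rpow_neg hd hφ
        _ ≤ gradSq φ := mul_le_of_le_one_left hG.le (Real.rpow_le_one (by positivity)
            (div_le_one_of_le₀ hGP hP.le) (by linarith))
    have hJeq : 1 / 2 * (gradSq φ + massSq φ) - ((d : ℝ) - 2) / (2 * (d : ℝ)) * critPow φ =
        1 / d * gradSq φ + 2 * α / (a * d) * massSq φ := by
      rw [hPeq, show 2 * α = (d * a - (d - 2) * b) / 2 by linarith]
      field_simp
      ring
    rw [hJeq]
    have h3 : 0 ≤ 2 * α / (a * d) * massSq φ := by positivity
    have h4 := mul_le_mul_of_nonneg_left hle (by positivity : 0 ≤ 1 / (d : ℝ))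
    linarith
  have hmem : ∀ φ : 𝓢(EuclideanSpace ℝ (Fin d), ℝ), φ ≠ 0 → ∀ r > 0,
      ((gradSq φ + b / a * (r ^ 2 * massSq φ)) / critPow φ) ^ (((d : ℝ) - 2) / 2) *
        (1 / d * gradSq φ + 2 * α / (a * d) * (r ^ 2 * massSq φ)) ∈ S := by
    intro φ hφ r hr
    have hG := gradSq_pos hd hφ
    have hM := massSq_nonneg φ
    obtain ⟨u, hu, hGu, hMu, hPu⟩ := exists_rescaling hd hφ hr
      (N := gradSq φ + b / a * (r ^ 2 * massSq φ)) (by positivity)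
    refine ⟨u, hu, ?_, ?_⟩
    · rw [hGu, hMu, hPu]
      field_simp
      ring
    · rw [hGu, hMu, hPu, show 2 * α = (d * a - (d - 2) * b) / 2 by linarith]
      field_simp
      ring
  have hbdd : BddBelow S := ⟨_, hlower⟩
  have hSne : S.Nonempty := ⟨_, hmem φ₀ hφ₀ 1 one_pos⟩
  refine le_antisymm ?_ (le_csInf hSne hlower)
  have hupper : ∀ φ : 𝓢(EuclideanSpace ℝ (Fin d), ℝ), φ ≠ 0 →
      d * sInf S ≤ sobolevQuotient φ ^ (-(d : ℝ)) := by
    intro φ hφ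
    have hcont : Tendsto (fun r : ℝ =>
        ((gradSq φ + b / a * (r ^ 2 * massSq φ)) / critPow φ) ^ (((d : ℝ) - 2) / 2) *
          (1 / d * gradSq φ + 2 * α / (a * d) * (r ^ 2 * massSq φ))) (𝓝[>] 0)
        (𝓝 (((gradSq φ + b / a * (0 ^ 2 * massSq φ)) / critPow φ) ^ (((d : ℝ) - 2) / 2) *
          (1 / d * gradSq φ + 2 * α / (a * d) * (0 ^ 2 * massSq φ)))) := by
      refine tendsto_nhdsWithin_of_tendsto_nhds (Continuous.tendsto ?_ 0)
      refine Continuous.mul (Continuous.rpow_const (by fun_prop) fun _ => Or.inr ?_) (by fun_prop)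
      linarith
    have h := ge_of_tendsto hcont (eventually_mem_nhdsWithin.mono fun r hr =>
      csInf_le hbdd (hmem φ hφ r hr))
    rw [sobolevQuotient_rpow_neg hd hφ]
    calc d * sInf S ≤ d * _ := mul_le_mul_of_nonneg_left h hd0.le
      _ = _ := by
        simp only [ne_eq, OfNat.ofNat_ne_zero, not_false_eq_true, zero_pow, zero_mul, mul_zero,
          add_zero]
        field_simp
  have hInf0 : 0 < d * sInf S := mul_pos hd0 ((by positivity : 0 < 1 / (d : ℝ) *
    CS ^ (-(d : ℝ))).trans_le (le_csInf hSne hlower))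
  have hCSle : CS ≤ (d * sInf S) ^ (-(d : ℝ))⁻¹ := by
    rw [hCS]
    refine csSup_le ⟨_, φ₀, hφ₀, rfl⟩ ?_
    rintro _ ⟨φ, hφ, rfl⟩
    exact (Real.le_rpow_inv_iff_of_neg (sobolevQuotient_pos hd hφ) hInf0 (by linarith)).2
      (hupper φ hφ)
  have h := (Real.le_rpow_inv_iff_of_neg hCS0 hInf0 (by linarith)).1 hCSle
  rw [one_div, ← div_eq_inv_mul, le_div_iff₀ hd0, mul_comm]
  exact h
end
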